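/- arXiv:0709.0910 — 5 statements merged into one kernel-verified Lean document; each statement's English description precedes it below -/
import Mathlib

section
/- Let n ≥ 3, let π be a permutation of [n], and let U be a nonempty proper subset of [n]. The half-line M(π) + ℝ≥0·M(χ^U) = {M(π) + t·M(χ^U) : t ≥ 0} is an extreme subset of closure(Q_n) (i.e., an unbounded edge of the polyhedron closure(Q_n)) if and only if neither U nor its complement [n]∖U is over the ridge from π. -/
open scoped BigOperators Pointwise

noncomputable def mmap {n : ℕ} (x : Fin n → ℝ) : Matrix (Fin n) (Fin n) ℝ :=
  fun k l => |x k - x l|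

noncomputable def chi {n : ℕ} (U : Finset (Fin n)) : Fin n → ℝ :=
  fun j => if j ∈ U then 1 else 0

noncomputable def permVec {n : ℕ} (π : Equiv.Perm (Fin n)) : Fin n → ℝ :=
  fun j => ((π j : ℕ) : ℝ) + 1

noncomputable def Mperm {n : ℕ} (π : Equiv.Perm (Fin n)) : Matrix (Fin n) (Fin n) ℝ :=
  mmap (permVec π)

def Npi {n : ℕ} (π : Equiv.Perm (Fin n)) : Set (Fin n → ℝ) :=
  {x | (∑ k, x k) = 0 ∧ ∀ k l : Fin n, π k < π l → x k ≤ x l}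

def Ebn (n : ℕ) : Set (Matrix (Fin n) (Fin n) ℝ) :=
  {X | ∃ x : Fin n → ℝ, (∀ k l : Fin n, k ≠ l → 1 ≤ |x k - x l|) ∧ X = mmap x}

noncomputable def Qn (n : ℕ) : Set (Matrix (Fin n) (Fin n) ℝ) :=
  convexHull ℝ (Ebn n)

noncomputable def Pn (n : ℕ) : Set (Matrix (Fin n) (Fin n) ℝ) :=
  convexHull ℝ {X | ∃ π : Equiv.Perm (Fin n), X = Mperm π}

noncomputable def cutCone (n : ℕ) : Set (Matrix (Fin n) (Fin n) ℝ) :=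
  {X | ∃ lam : Finset (Fin n) → ℝ, (∀ U, 0 ≤ lam U) ∧
    X = ∑ U : Finset (Fin n), lam U • mmap (chi U)}

def incident {n : ℕ} (π : Equiv.Perm (Fin n)) (U : Finset (Fin n)) : Prop :=
  U.Nonempty ∧ U ≠ Finset.univ ∧ ∀ j, j ∈ U ↔ (π j : ℕ) + 1 ≤ U.card

def overRidge {n : ℕ} (π : Equiv.Perm (Fin n)) (V : Finset (Fin n)) : Prop :=
  ∃ k : ℕ, 1 ≤ k ∧ k ≤ n - 1 ∧
    ∀ j, j ∈ V ↔ ((π j : ℕ) + 1 ≤ k - 1 ∨ (π j : ℕ) + 1 = k + 1)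

noncomputable def halfline {n : ℕ} (π : Equiv.Perm (Fin n)) (U : Finset (Fin n)) :
    Set (Matrix (Fin n) (Fin n) ℝ) :=
  {X | ∃ t : ℝ, 0 ≤ t ∧ X = Mperm π + t • mmap (chi U)}

noncomputable def antipode {n : ℕ} (π : Equiv.Perm (Fin n)) : Equiv.Perm (Fin n) :=
  π.trans Fin.revPerm

def dd (y : ℕ → ℤ) (i j : ℕ) : ℤ := ((y i - y j).natAbs : ℤ)

def ev (L : List (ℤ × ℕ × ℕ)) (y : ℕ → ℤ) : ℤ :=
  (L.map fun e => e.1 * dd y e.2.1 e.2.2).sum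

def idz : ℕ → ℤ := fun i => (i : ℤ)

structure Sys (n : ℕ) (u : ℕ → ℤ) (A B : Set (ℕ → ℤ)) : Prop where
  u01 : ∀ i, u i = 0 ∨ u i = 1
  inj : ∀ y ∈ A, ∀ i j, i < n → j < n → i ≠ j → y i ≠ y j
  bdd : ∀ y ∈ A, ∀ i j, i < n → j < n → y i - y j ≤ (n : ℤ) - 1
  b01 : ∀ c ∈ B, ∀ i, c i = 0 ∨ c i = 1
  H : ∀ L : List (ℤ × ℕ × ℕ), (∀ e ∈ L, e.2.1 < n ∧ e.2.2 < n) → ev L u = 0 →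
    (∀ y ∈ A, ev L idz ≤ ev L y) → (∀ c ∈ B, 0 ≤ ev L c) →
    (∀ y ∈ A, ev L y = ev L idz) ∧ (∀ c ∈ B, ev L c = 0)

def RigA (y : ℕ → ℤ) (p q : ℕ) : Prop :=
  (∀ i, p ≤ i → i ≤ q → y i = y p + ((i : ℤ) - p)) ∨
  (∀ i, p ≤ i → i ≤ q → y i = y p - ((i : ℤ) - p))

def RigB (u c : ℕ → ℤ) (p q : ℕ) : Prop :=
  (∀ i, p ≤ i → i ≤ q → c i = c p) ∨
  (∀ i, p ≤ i → i ≤ q → (c i = c p ↔ u i = u p))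

def Rig (u : ℕ → ℤ) (A B : Set (ℕ → ℤ)) (p q : ℕ) : Prop :=
  (∀ y ∈ A, RigA y p q) ∧ (∀ c ∈ B, RigB u c p q)

lemma key_abs (x y : ℤ) (h : x ≠ y) : (x + 1 ≤ y ∧ ((x - y).natAbs : ℤ) = y - x) ∨
    (y + 1 ≤ x ∧ ((x - y).natAbs : ℤ) = x - y) := by omega

set_option maxHeartbeats 2000000 in
lemma cfun (a b c d e : ℤ) (h1 : a ≠ b) (h2 : a ≠ c) (h3 : a ≠ d) (h4 : a ≠ e) (h5 : b ≠ c)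
    (h6 : b ≠ d) (h7 : b ≠ e) (h8 : c ≠ d) (h9 : c ≠ e) (h10 : d ≠ e) :
    (5:ℤ) ≤ ((a - b).natAbs : ℤ) + ((d - e).natAbs : ℤ) - 2 * ((a - d).natAbs : ℤ)
      - 2 * ((b - e).natAbs : ℤ) + ((b - c).natAbs : ℤ) + ((c - d).natAbs : ℤ) +
     2 * ((a - c).natAbs : ℤ) + 2 * ((c - e).natAbs : ℤ) + 2 * ((b - d).natAbs : ℤ) ∨
     (b = a + 1 ∧ c = a + 2 ∧ d = a + 3 ∧ e = a + 4) ∨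
     (b = a - 1 ∧ c = a - 2 ∧ d = a - 3 ∧ e = a - 4) := by
  have k1 := key_abs a b h1
  have k2 := key_abs b c h5
  have k3 := key_abs a c h2
  have k4 := key_abs a d h3
  have k5 := key_abs b d h6
  have k6 := key_abs c d h8
  have k7 := key_abs b e h7
  have k8 := key_abs c e h9
  have k9 := key_abs d e h10
  have k10 : a + 1 ≤ e ∨ e + 1 ≤ a := by omega
  clear h1 h2 h3 h4 h5 h6 h7 h8 h9 h10
  generalize ((a - b).natAbs : ℤ) = ab at *
  generalize ((b - c).natAbs : ℤ) = bc at *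
  generalize ((a - c).natAbs : ℤ) = ac at *
  generalize ((a - d).natAbs : ℤ) = ad at *
  generalize ((b - d).natAbs : ℤ) = bd at *
  generalize ((c - d).natAbs : ℤ) = cd at *
  generalize ((b - e).natAbs : ℤ) = be at *
  generalize ((c - e).natAbs : ℤ) = ce at *
  generalize ((d - e).natAbs : ℤ) = de at *
  rcases k1 with ⟨i1, rfl⟩ | ⟨i1, rfl⟩ <;>
  rcases k2 with ⟨i2, rfl⟩ | ⟨i2, rfl⟩ <;>
  rcases k3 with ⟨i3, rfl⟩ | ⟨i3, rfl⟩ <;> first | (exfalso; linarith) | skip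
  all_goals
    rcases k4 with ⟨i4, rfl⟩ | ⟨i4, rfl⟩ <;>
    rcases k5 with ⟨i5, rfl⟩ | ⟨i5, rfl⟩ <;> first | (exfalso; linarith) | skip
  all_goals
    rcases k6 with ⟨i6, rfl⟩ | ⟨i6, rfl⟩ <;> first | (exfalso; linarith) | skip
  all_goals
    rcases k7 with ⟨i7, rfl⟩ | ⟨i7, rfl⟩ <;>
    rcases k8 with ⟨i8, rfl⟩ | ⟨i8, rfl⟩ <;> first | (exfalso; linarith) | skip
  all_goals
    rcases k9 with ⟨i9, rfl⟩ | ⟨i9, rfl⟩ <;> first | (left; linarith) | (exfalso; linarith) | skip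
  all_goals
    rcases k10 with i10 | i10 <;> first | (left; linarith) | (exfalso; linarith) | omega

section core
variable {n : ℕ} {u : ℕ → ℤ} {A B : Set (ℕ → ℤ)}

lemma Sys.adj (S : Sys n u A B) {i : ℕ} (hi : i + 1 < n) (h : u i = u (i+1)) :
    (∀ y ∈ A, (y i - y (i+1)).natAbs = 1) ∧ (∀ c ∈ B, c i = c (i+1)) := by
  have := S.H [(1, i, i+1)] (by simp; omega) (by simp [ev, dd, h])
    (by intro y hy
        have := S.inj y hy i (i+1) (by omega) (by omega) (by omega)
        simp only [ev, dd, idz, List.map_cons, List.map_nil, List.sum_cons, List.sum_nil]; omega)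
    (by intro y hy; simp [ev, dd])
  simp only [ev, dd, idz, List.map_cons, List.map_nil, List.sum_cons, List.sum_nil] at this
  refine ⟨fun y hy => ?_, fun c hc => ?_⟩
  · have := this.1 y hy; omega
  · have := this.2 c hc; omega

lemma Sys.tri (S : Sys n u A B) {i j k : ℕ} (hij : i < j) (hjk : j < k) (hk : k < n)
    (h : u j = u i ∨ u j = u k) :
    (∀ y ∈ A, (y i < y j ∧ y j < y k) ∨ (y k < y j ∧ y j < y i)) := by
  have := S.H [(1, i, j), (1, j, k), (-1, i, k)] (by simp; omega)
    (by simp only [ev, dd, idz, List.map_cons, List.map_nil, List.sum_cons, List.sum_nil]; rcases h with h | h <;> rw [h] <;> omega)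
    (by intro y hy
        simp only [ev, dd, idz, List.map_cons, List.map_nil, List.sum_cons, List.sum_nil]; omega)
    (by intro y hy; simp only [ev, dd, idz, List.map_cons, List.map_nil, List.sum_cons, List.sum_nil]; omega)
  simp only [ev, dd, idz, List.map_cons, List.map_nil, List.sum_cons, List.sum_nil] at this
  intro y hy
  have h1 := this.1 y hy
  have := S.inj y hy i j (by omega) (by omega) (by omega)
  have := S.inj y hy j k (by omega) (by omega) (by omega)
  omega

lemma Rig.extR (S : Sys n u A B) {p q j : ℕ} (R : Rig u A B p q) (hq : q + 1 < n)
    (hpj : p ≤ j) (hjq : j ≤ q) (hu : u j = u (q+1)) (hj : p < j ∨ p = q) :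
    Rig u A B p (q+1) := by
  have key : ∀ y ∈ A, (q:ℤ) + 1 - j ≤ ((y j - y (q+1)).natAbs : ℤ) ∧
      ((q:ℤ) + 1 - j = ((y j - y (q+1)).natAbs : ℤ) → RigA y p (q+1)) := by
    intro y hy
    have hne : y q ≠ y (q+1) := S.inj y hy q (q+1) (by omega) (by omega) (by omega)
    rcases hj with hj | hj
    · have ht := S.tri hj (by omega : j < q+1) hq (Or.inr hu) y hy
      rcases R.1 y hy with h | h
      · have hjv := h j hpj hjq
        have hgt : y q < y (q+1) := by
          by_contra hcon
          obtain ⟨m, hm⟩ : ∃ m : ℕ, (m : ℤ) = y (q+1) - y p := ⟨(y (q+1) - y p).toNat, by omega⟩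
          have hqv := h q (by omega) le_rfl
          have hm2 := h (p + m) (by omega) (by omega)
          exact S.inj y hy (p+m) (q+1) (by omega) hq (by omega) (by push_cast at hm2; omega)
        have hqv := h q (by omega) le_rfl
        refine ⟨by omega, fun he => Or.inl fun i hi hi2 => ?_⟩
        rcases Nat.lt_or_ge q i with hlt | hge
        · obtain rfl : i = q + 1 := by omega
          push_cast; omega
        · exact h i hi hge
      · have hjv := h j hpj hjq
        have hgt : y (q+1) < y q := by
          by_contra hcon
          obtain ⟨m, hm⟩ : ∃ m : ℕ, (m : ℤ) = y p - y (q+1) := ⟨(y p - y (q+1)).toNat, by omega⟩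
          have hqv := h q (by omega) le_rfl
          have hm2 := h (p + m) (by omega) (by omega)
          exact S.inj y hy (p+m) (q+1) (by omega) hq (by omega) (by push_cast at hm2; omega)
        have hqv := h q (by omega) le_rfl
        refine ⟨by omega, fun he => Or.inr fun i hi hi2 => ?_⟩
        rcases Nat.lt_or_ge q i with hlt | hge
        · obtain rfl : i = q + 1 := by omega
          push_cast; omega
        · exact h i hi hge
    · subst hj
      obtain rfl : j = p := by omega
      refine ⟨by omega, fun he => ?_⟩
      rcases lt_or_gt_of_ne hne with hl | hl
      · refine Or.inl fun i hi hi2 => ?_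
        rcases (by omega : i = j ∨ i = j + 1) with rfl | rfl <;> push_cast <;> omega
      · refine Or.inr fun i hi hi2 => ?_
        rcases (by omega : i = j ∨ i = j + 1) with rfl | rfl <;> push_cast <;> omega
  have := S.H [(1, j, q+1)] (by simp; omega) (by simp [ev, dd, hu])
    (by intro y hy
        have := (key y hy).1
        simp only [ev, dd, idz, List.map_cons, List.map_nil, List.sum_cons, List.sum_nil]; omega)
    (by intro y hy; simp [ev, dd])
  simp only [ev, dd, idz, List.map_cons, List.map_nil, List.sum_cons, List.sum_nil] at this
  refine ⟨fun y hy => (key y hy).2 ?_, fun c hc => ?_⟩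
  · have := this.1 y hy; omega
  · have h1 := this.2 c hc
    have h2 : c j = c (q+1) := by omega
    rcases R.2 c hc with h | h
    · refine Or.inl fun i hi hi2 => ?_
      rcases Nat.lt_or_ge q i with hlt | hge
      · obtain rfl : i = q + 1 := by omega
        rw [← h2]; exact h j hpj hjq
      · exact h i hi hge
    · refine Or.inr fun i hi hi2 => ?_
      rcases Nat.lt_or_ge q i with hlt | hge
      · obtain rfl : i = q + 1 := by omega
        rw [← h2, ← hu]; exact h j hpj hjq
      · exact h i hi hge

lemma Rig.single (p : ℕ) : Rig u A B p p := by
  refine ⟨fun y _ => Or.inl fun i h1 h2 => ?_, fun c _ => Or.inl fun i h1 h2 => ?_⟩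
  · obtain rfl : i = p := by omega
    simp
  · obtain rfl : i = p := by omega
    rfl

/-- runs are rigid -/
lemma Sys.run (S : Sys n u A B) {p : ℕ} : ∀ q, p ≤ q → q < n →
    (∀ i, p ≤ i → i ≤ q → u i = u p) → Rig u A B p q := by
  intro q hpq
  induction q, hpq using Nat.le_induction with
  | base => intro _ _; exact Rig.single p
  | succ q hpq ih =>
    intro hq hu
    have R := ih (by omega) (fun i h1 h2 => hu i h1 (by omega))
    exact R.extR S hq hpq le_rfl (by rw [hu q hpq (by omega), hu (q+1) (by omega) le_rfl]) (by omega)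

/-- reflected system -/
lemma Sys.refl (S : Sys n u A B) : Sys n (fun i => u (n - 1 - i))
    ((fun y i => y (n - 1 - i)) '' A) ((fun y i => y (n - 1 - i)) '' B) where
  u01 := fun i => S.u01 _
  inj := by
    rintro _ ⟨y, hy, rfl⟩ i j hi hj hij
    exact S.inj y hy _ _ (by omega) (by omega) (by omega)
  bdd := by
    rintro _ ⟨y, hy, rfl⟩ i j hi hj
    exact S.bdd y hy _ _ (by omega) (by omega)
  b01 := by
    rintro _ ⟨y, hy, rfl⟩ i
    exact S.b01 y hy _
  H := by
    intro L hL hu hA hB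
    let L' : List (ℤ × ℕ × ℕ) := L.map fun e => (e.1, n - 1 - e.2.1, n - 1 - e.2.2)
    have e1 : ∀ y : ℕ → ℤ, ev L' y = ev L (fun i => y (n - 1 - i)) := by
      intro y; simp [L', ev, dd, Function.comp_def]
    have e2 : ev L' idz = ev L idz := by
      simp only [L', ev, List.map_map]
      congr 1
      refine List.map_congr_left fun e he => ?_
      have := hL e he
      simp only [dd, idz, Function.comp]
      congr 1
      omega
    have := S.H L' ?_ (by rw [e1]; exact hu) ?_ ?_
    · refine ⟨?_, ?_⟩
      · rintro _ ⟨y, hy, rfl⟩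
        have := this.1 y hy
        rw [← e2, ← this, e1]
      · rintro _ ⟨y, hy, rfl⟩
        have := this.2 y hy
        rw [← this, e1]
    · intro e he
      simp only [L', List.mem_map] at he
      obtain ⟨a, ha, rfl⟩ := he
      have := hL a ha
      simp only; omega
    · intro y hy
      rw [e2, e1]; exact hA _ ⟨y, hy, rfl⟩
    · intro y hy
      rw [e1]; exact hB _ ⟨y, hy, rfl⟩

lemma Rig.reflect (S : Sys n u A B) {p q : ℕ} (hpq : p ≤ q) (hq : q < n) (R : Rig u A B p q) :
    Rig (fun i => u (n - 1 - i))
    ((fun y i => y (n - 1 - i)) '' A) ((fun y i => y (n - 1 - i)) '' B) (n-1-q) (n-1-p) := by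
  refine ⟨?_, ?_⟩
  · rintro _ ⟨y, hy, rfl⟩
    rcases R.1 y hy with h | h
    · refine Or.inr fun i h1 h2 => ?_
      have a := h (n-1-i) (by omega) (by omega)
      have b := h (n-1-(n-1-q)) (by omega) (by omega)
      simp only; omega
    · refine Or.inl fun i h1 h2 => ?_
      have a := h (n-1-i) (by omega) (by omega)
      have b := h (n-1-(n-1-q)) (by omega) (by omega)
      simp only; omega
  · rintro _ ⟨c, hc, rfl⟩
    rcases R.2 c hc with h | h
    · refine Or.inl fun i h1 h2 => ?_
      have a := h (n-1-i) (by omega) (by omega)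
      have b := h (n-1-(n-1-q)) (by omega) (by omega)
      simp only; omega
    · refine Or.inr fun i h1 h2 => ?_
      have a := h (n-1-i) (by omega) (by omega)
      have b := h (n-1-(n-1-q)) (by omega) (by omega)
      have := S.b01 c hc (n-1-i)
      have := S.b01 c hc (n-1-(n-1-q))
      have := S.b01 c hc p
      have := S.u01 (n-1-i)
      have := S.u01 (n-1-(n-1-q))
      have := S.u01 p
      simp only; omega

/-- extension to the right end -/
lemma Rig.extRall (S : Sys n u A B) {p : ℕ} {q : ℕ} (R : Rig u A B p q) (hq : q < n)
    (h0 : ∃ j, p < j ∧ j ≤ q ∧ u j = 0) (h1 : ∃ j, p < j ∧ j ≤ q ∧ u j = 1) :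
    ∀ m, q ≤ m → m < n → Rig u A B p m := by
  intro m hm
  induction m, hm using Nat.le_induction with
  | base => intro _; exact R
  | succ m hm ih =>
    intro hmn
    obtain ⟨j0, a0, b0, c0⟩ := h0
    obtain ⟨j1, a1, b1, c1⟩ := h1
    rcases S.u01 (m+1) with h | h
    · exact (ih (by omega)).extR S hmn a0.le (by omega) (by rw [h, c0]) (Or.inl a0)
    · exact (ih (by omega)).extR S hmn a1.le (by omega) (by rw [h, c1]) (Or.inl a1)

lemma Rig.extAll (S : Sys n u A B) {p q : ℕ} (R : Rig u A B p q) (hq : q < n)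
    (h0 : ∃ j, p < j ∧ j ≤ q ∧ u j = 0) (h1 : ∃ j, p < j ∧ j ≤ q ∧ u j = 1)
    (k0 : ∃ j, p ≤ j ∧ j < q ∧ u j = 0) (k1 : ∃ j, p ≤ j ∧ j < q ∧ u j = 1) :
    Rig u A B 0 (n-1) := by
  have R1 := R.extRall S hq h0 h1 (n-1) (by omega) (by omega)
  obtain ⟨j0, a0, b0, c0⟩ := k0
  obtain ⟨j1, a1, b1, c1⟩ := k1
  have hj0 : n - 1 - (n - 1 - j0) = j0 := by omega
  have hj1 : n - 1 - (n - 1 - j1) = j1 := by omega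
  have R2 := (R1.reflect S (by omega) (by omega)).extRall S.refl (by omega)
    ⟨n-1-j0, by omega, by omega, by simp only [hj0]; exact c0⟩
    ⟨n-1-j1, by omega, by omega, by simp only [hj1]; exact c1⟩ (n-1) (by omega) (by omega)
  have R3 := R2.reflect S.refl (by omega) (by omega)
  have e : n - 1 - (n - 1) = 0 := by omega
  simp only [e, Set.image_image] at R3
  have hre : ∀ i, i ≤ n - 1 → n - 1 - (n - 1 - i) = i := fun i hi => by omega
  refine ⟨fun y hy => ?_, fun c hc => ?_⟩
  · have := R3.1 _ ⟨y, hy, rfl⟩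
    rcases this with h | h
    · refine Or.inl fun i hi hi2 => ?_
      have := h i hi (by omega)
      simpa [hre i hi2] using this
    · refine Or.inr fun i hi hi2 => ?_
      have := h i hi (by omega)
      simpa [hre i hi2] using this
  · have := R3.2 _ ⟨c, hc, rfl⟩
    rcases this with h | h
    · refine Or.inl fun i hi hi2 => ?_
      have := h i hi (by omega)
      simpa [hre i hi2] using this
    · refine Or.inr fun i hi hi2 => ?_
      have := h i hi (by omega)
      simpa [hre i hi2] using this

set_option maxHeartbeats 2000000 in
/-- window `0 1^q 0`, `q ≥ 2` -/
lemma Sys.winA (S : Sys n u A B) {p r : ℕ} (hpr : p + 3 ≤ r) (hr : r < n)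
    (hrun : ∀ i, p + 1 ≤ i → i ≤ r - 1 → u i = u (p+1)) (hp : u p ≠ u (p+1))
    (hr' : u r ≠ u (p+1)) : Rig u A B p r := by
  have R := S.run (p := p+1) (r-1) (by omega) (by omega) hrun
  have u1 := S.u01 p
  have u2 := S.u01 (p+1)
  have u3 := S.u01 r
  have u4 := hrun (r-1) (by omega) le_rfl
  have cB : ∀ c ∈ B, ∀ i, p + 1 ≤ i → i ≤ r - 1 → c i = c (p+1) := by
    intro c hc
    rcases R.2 c hc with h | h
    · exact h
    · intro i h1 h2; exact (h i h1 h2).2 (hrun i h1 h2)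
  have key : ∀ y ∈ A, (2 * ((r:ℤ) - p) - 6 * ((r:ℤ) - p - 2) ≤
      2 * (y p - y r).natAbs + 3 * (y p - y (p+1)).natAbs + 3 * (y (r-1) - y r).natAbs
       - 3 * (y p - y (r-1)).natAbs - 3 * (y (p+1) - y r).natAbs) ∧
      (2 * ((r:ℤ) - p) - 6 * ((r:ℤ) - p - 2) =
      2 * (y p - y r).natAbs + 3 * (y p - y (p+1)).natAbs + 3 * (y (r-1) - y r).natAbs
       - 3 * (y p - y (r-1)).natAbs - 3 * (y (p+1) - y r).natAbs → RigA y p r) := by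
    intro y hy
    have hpr2 := S.inj y hy p r (by omega) (by omega) (by omega)
    rcases R.1 y hy with h | h
    · have out : ∀ z, z < n → (z < p + 1 ∨ r - 1 < z) → y z < y (p+1) ∨ y (r-1) < y z := by
        intro z hz hz2
        by_contra hcon
        push Not at hcon
        obtain ⟨m, hm⟩ : ∃ m : ℕ, (m : ℤ) = y z - y (p+1) := ⟨(y z - y (p+1)).toNat, by omega⟩
        have hqv := h (r-1) (by omega) le_rfl
        have hm2 := h (p + 1 + m) (by omega) (by omega)
        exact S.inj y hy (p+1+m) z (by omega) hz (by omega) (by push_cast at hm2; omega)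
      have o1 := out p (by omega) (by omega)
      have o2 := out r (by omega) (by omega)
      have hqv := h (r-1) (by omega) le_rfl
      refine ⟨by omega, fun he => ?_⟩
      have h3 : y p = y (p+1) - 1 ∧ y r = y (r-1) + 1 := by omega
      refine Or.inl fun i hi hi2 => ?_
      rcases (by omega : i = p ∨ i = r ∨ (p + 1 ≤ i ∧ i ≤ r - 1)) with rfl | rfl | ⟨h4, h5⟩
      · omega
      · omega
      · have := h i h4 h5; omega
    · have out : ∀ z, z < n → (z < p + 1 ∨ r - 1 < z) → y (p+1) < y z ∨ y z < y (r-1) := by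
        intro z hz hz2
        by_contra hcon
        push Not at hcon
        obtain ⟨m, hm⟩ : ∃ m : ℕ, (m : ℤ) = y (p+1) - y z := ⟨(y (p+1) - y z).toNat, by omega⟩
        have hqv := h (r-1) (by omega) le_rfl
        have hm2 := h (p + 1 + m) (by omega) (by omega)
        exact S.inj y hy (p+1+m) z (by omega) hz (by omega) (by push_cast at hm2; omega)
      have o1 := out p (by omega) (by omega)
      have o2 := out r (by omega) (by omega)
      have hqv := h (r-1) (by omega) le_rfl
      refine ⟨by omega, fun he => ?_⟩
      have h3 : y p = y (p+1) + 1 ∧ y r = y (r-1) - 1 := by omega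
      refine Or.inr fun i hi hi2 => ?_
      rcases (by omega : i = p ∨ i = r ∨ (p + 1 ≤ i ∧ i ≤ r - 1)) with rfl | rfl | ⟨h4, h5⟩
      · omega
      · omega
      · have := h i h4 h5; omega
  have := S.H [(2, p, r), (3, p, p+1), (3, r-1, r), (-3, p, r-1), (-3, p+1, r)]
    (by simp; omega)
    (by simp only [ev, dd, idz, List.map_cons, List.map_nil, List.sum_cons, List.sum_nil]
        rw [u4]; omega)
    (by intro y hy
        have := (key y hy).1
        simp only [ev, dd, idz, List.map_cons, List.map_nil, List.sum_cons, List.sum_nil]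
        omega)
    (by intro c hc
        have := cB c hc (r-1) (by omega) le_rfl
        simp only [ev, dd, idz, List.map_cons, List.map_nil, List.sum_cons, List.sum_nil]
        rw [this]; omega)
  simp only [ev, dd, idz, List.map_cons, List.map_nil, List.sum_cons, List.sum_nil] at this
  refine ⟨fun y hy => (key y hy).2 ?_, fun c hc => ?_⟩
  · have := this.1 y hy; omega
  · have h1 := this.2 c hc
    have h2 := cB c hc (r-1) (by omega) le_rfl
    have h3 : c p = c r := by rw [h2] at h1; omega
    have := S.b01 c hc p
    have := S.b01 c hc (p+1)
    by_cases h4 : c p = c (p+1)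
    · refine Or.inl fun i hi hi2 => ?_
      rcases (by omega : i = p ∨ i = r ∨ (p + 1 ≤ i ∧ i ≤ r - 1)) with rfl | rfl | ⟨h5, h6⟩
      · rfl
      · exact h3.symm
      · rw [cB c hc i h5 h6, h4]
    · refine Or.inr fun i hi hi2 => ?_
      rcases (by omega : i = p ∨ i = r ∨ (p + 1 ≤ i ∧ i ≤ r - 1)) with rfl | rfl | ⟨h5, h6⟩
      · simp
      · omega
      · rw [cB c hc i h5 h6, hrun i h5 h6]; omega

/-- window `00100` -/
lemma Sys.winB (S : Sys n u A B) {p : ℕ} (hr : p + 4 < n)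
    (h1 : u (p+1) = u p) (h2 : u (p+2) ≠ u p) (h3 : u (p+3) = u p) (h4 : u (p+4) = u p) :
    Rig u A B p (p+4) := by
  have a1 := S.adj (i := p) (by omega) h1.symm
  have a2 := S.adj (i := p+3) (by omega) (by show u (p+3) = u (p+4); omega)
  have t1 := S.tri (i := p) (j := p+1) (k := p+2) (by omega) (by omega) (by omega) (Or.inl h1)
  have t2 := S.tri (i := p) (j := p+1) (k := p+3) (by omega) (by omega) (by omega) (Or.inl h1)
  have t3 := S.tri (i := p+1) (j := p+3) (k := p+4) (by omega) (by omega) (by omega)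
    (Or.inr (by omega))
  have t4 := S.tri (i := p+2) (j := p+3) (k := p+4) (by omega) (by omega) (by omega)
    (Or.inr (by omega))
  have key : ∀ y ∈ A, 2 ≤ (y (p+1) - y (p+3)).natAbs := by
    intro y hy
    have := t1 y hy
    have := t2 y hy
    have := t3 y hy
    have := t4 y hy
    have := a2.1 y hy
    have : y (p+2) ≠ y (p+3) := S.inj y hy _ _ (by omega) (by omega) (by omega)
    have : y (p+2) ≠ y (p+4) := S.inj y hy _ _ (by omega) (by omega) (by omega)
    simp only [Nat.add_assoc, Nat.reduceAdd] at *
    omega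
  have := S.H [(1, p+1, p+3)] (by simp; omega)
    (by simp only [ev, dd, idz, List.map_cons, List.map_nil, List.sum_cons, List.sum_nil]
        rw [h1, h3]; omega)
    (by intro y hy
        have := key y hy
        simp only [ev, dd, idz, List.map_cons, List.map_nil, List.sum_cons, List.sum_nil]
        omega)
    (by intro c hc
        simp only [ev, dd, idz, List.map_cons, List.map_nil, List.sum_cons, List.sum_nil]
        omega)
  simp only [ev, dd, idz, List.map_cons, List.map_nil, List.sum_cons, List.sum_nil] at this
  refine ⟨fun y hy => ?_, fun c hc => ?_⟩
  · have := this.1 y hy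
    have := t1 y hy
    have := t2 y hy
    have := t3 y hy
    have := t4 y hy
    have := a2.1 y hy
    have := a1.1 y hy
    have : y (p+2) ≠ y (p+3) := S.inj y hy _ _ (by omega) (by omega) (by omega)
    have : y (p+2) ≠ y (p+4) := S.inj y hy _ _ (by omega) (by omega) (by omega)
    simp only [Nat.add_assoc, Nat.reduceAdd] at *
    have : (y (p+1) = y p + 1 ∧ y (p+2) = y p + 2 ∧ y (p+3) = y p + 3 ∧ y (p+4) = y p + 4) ∨
      (y (p+1) = y p - 1 ∧ y (p+2) = y p - 2 ∧ y (p+3) = y p - 3 ∧ y (p+4) = y p - 4) := by omega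
    refine this.imp ?_ ?_
    · rintro ⟨b1, b2, b3, b4⟩ i hi hi2
      rcases (by omega : i = p ∨ i = p+1 ∨ i = p+2 ∨ i = p+3 ∨ i = p+4) with
        rfl | rfl | rfl | rfl | rfl <;> push_cast <;> omega
    · rintro ⟨b1, b2, b3, b4⟩ i hi hi2
      rcases (by omega : i = p ∨ i = p+1 ∨ i = p+2 ∨ i = p+3 ∨ i = p+4) with
        rfl | rfl | rfl | rfl | rfl <;> push_cast <;> omega
  · have := this.2 c hc
    have := a1.2 c hc
    have := a2.2 c hc
    simp only [Nat.add_assoc, Nat.reduceAdd] at *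
    by_cases h5 : c (p+2) = c p
    · refine Or.inl fun i hi hi2 => ?_
      rcases (by omega : i = p ∨ i = p+1 ∨ i = p+2 ∨ i = p+3 ∨ i = p+4) with
        rfl | rfl | rfl | rfl | rfl <;> omega
    · refine Or.inr fun i hi hi2 => ?_
      rcases (by omega : i = p ∨ i = p+1 ∨ i = p+2 ∨ i = p+3 ∨ i = p+4) with
        rfl | rfl | rfl | rfl | rfl <;> omega

/-- window `01010` -/
lemma Sys.winC (S : Sys n u A B) {p : ℕ} (hr : p + 4 < n)
    (h1 : u (p+1) ≠ u p) (h2 : u (p+2) = u p) (h3 : u (p+3) ≠ u p) (h4 : u (p+4) = u p) :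
    Rig u A B p (p+4) := by
  have h31 : u (p+3) = u (p+1) := by
    have := S.u01 p
    have := S.u01 (p+1)
    have := S.u01 (p+3)
    omega
  have key : ∀ y ∈ A, _ := fun y hy => cfun (y p) (y (p+1)) (y (p+2)) (y (p+3)) (y (p+4))
    (S.inj y hy _ _ (by omega) (by omega) (by omega))
    (S.inj y hy _ _ (by omega) (by omega) (by omega))
    (S.inj y hy _ _ (by omega) (by omega) (by omega))
    (S.inj y hy _ _ (by omega) (by omega) (by omega))
    (S.inj y hy _ _ (by omega) (by omega) (by omega))
    (S.inj y hy _ _ (by omega) (by omega) (by omega))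
    (S.inj y hy _ _ (by omega) (by omega) (by omega))
    (S.inj y hy _ _ (by omega) (by omega) (by omega))
    (S.inj y hy _ _ (by omega) (by omega) (by omega))
    (S.inj y hy _ _ (by omega) (by omega) (by omega))
  have keyB : ∀ c ∈ B, 0 ≤ ev [(1, p, p+1), (1, p+3, p+4), (-2, p, p+3), (-2, p+1, p+4),
      (1, p+1, p+2), (1, p+2, p+3), (2, p, p+2), (2, p+2, p+4), (2, p+1, p+3)] c ∧
      (ev [(1, p, p+1), (1, p+3, p+4), (-2, p, p+3), (-2, p+1, p+4),
      (1, p+1, p+2), (1, p+2, p+3), (2, p, p+2), (2, p+2, p+4), (2, p+1, p+3)] c = 0 →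
      c (p+2) = c p ∧ c (p+4) = c p ∧ c (p+3) = c (p+1)) := by
    intro c hc
    simp only [ev, dd, idz, List.map_cons, List.map_nil, List.sum_cons, List.sum_nil]
    have b0 := S.b01 c hc p
    have b1 := S.b01 c hc (p+1)
    have b2 := S.b01 c hc (p+2)
    have b3 := S.b01 c hc (p+3)
    have b4 := S.b01 c hc (p+4)
    rcases b0 with b0 | b0 <;> rcases b1 with b1 | b1 <;> rcases b2 with b2 | b2 <;>
      rcases b3 with b3 | b3 <;> rcases b4 with b4 | b4 <;> rw [b0, b1, b2, b3, b4] <;> decide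
  have := S.H [(1, p, p+1), (1, p+3, p+4), (-2, p, p+3), (-2, p+1, p+4),
      (1, p+1, p+2), (1, p+2, p+3), (2, p, p+2), (2, p+2, p+4), (2, p+1, p+3)] (by simp; omega)
    (by simp only [ev, dd, idz, List.map_cons, List.map_nil, List.sum_cons, List.sum_nil]
        rw [h31, h2, h4]; omega)
    (by intro y hy
        have h := key y hy
        simp only [ev, dd, idz, List.map_cons, List.map_nil, List.sum_cons, List.sum_nil]
        rcases h with h | ⟨e1, e2, e3, e4⟩ | ⟨e1, e2, e3, e4⟩
        · push_cast at *
          ring_nf at *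
          norm_num
          omega
        · rw [e1, e2, e3, e4]; push_cast; ring_nf; norm_num
        · rw [e1, e2, e3, e4]; push_cast; ring_nf; norm_num)
    (fun c hc => (keyB c hc).1)
  refine ⟨fun y hy => ?_, fun c hc => ?_⟩
  · have h := key y hy
    have h5 := this.1 y hy
    simp only [ev, dd, idz, List.map_cons, List.map_nil, List.sum_cons, List.sum_nil] at h5
    rcases h with h8 | h
    · exfalso
      push_cast at h8 h5
      ring_nf at h8 h5
      norm_num at h5
      omega
    refine h.imp ?_ ?_
    · rintro ⟨b1, b2, b3, b4⟩ i hi hi2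
      rcases (by omega : i = p ∨ i = p+1 ∨ i = p+2 ∨ i = p+3 ∨ i = p+4) with
        rfl | rfl | rfl | rfl | rfl <;> push_cast <;> omega
    · rintro ⟨b1, b2, b3, b4⟩ i hi hi2
      rcases (by omega : i = p ∨ i = p+1 ∨ i = p+2 ∨ i = p+3 ∨ i = p+4) with
        rfl | rfl | rfl | rfl | rfl <;> push_cast <;> omega
  · obtain ⟨b2, b4, b3⟩ := (keyB c hc).2 (this.2 c hc)
    by_cases h5 : c (p+1) = c p
    · refine Or.inl fun i hi hi2 => ?_
      rcases (by omega : i = p ∨ i = p+1 ∨ i = p+2 ∨ i = p+3 ∨ i = p+4) with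
        rfl | rfl | rfl | rfl | rfl <;> omega
    · refine Or.inr fun i hi hi2 => ?_
      rcases (by omega : i = p ∨ i = p+1 ∨ i = p+2 ∨ i = p+3 ∨ i = p+4) with
        rfl | rfl | rfl | rfl | rfl <;> omega

end core
section core2
variable {n : ℕ} {u : ℕ → ℤ} {A B : Set (ℕ → ℤ)}

lemma Sys.twoBlock (S : Sys n u A B) (hn : 3 ≤ n) {p : ℕ} (hp : 0 < p) (hpn : p < n)
    (h0 : ∀ i, i < p → u i = u 0) (h1 : ∀ i, p ≤ i → i < n → u i = u p) (h01 : u p ≠ u 0) :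
    Rig u A B 0 (n-1) := by
  have R0 := S.run (p := 0) (p-1) (by omega) (by omega) (fun i _ h => h0 i (by omega))
  have R1 := S.run (p := p) (n-1) (by omega) (by omega) (fun i h2 h => h1 i h2 (by omega))
  have up := h0 (p-1) (by omega)
  have un := h1 (n-1) (by omega) (by omega)
  refine ⟨fun y hy => ?_, fun c hc => ?_⟩
  · have b1 := S.bdd y hy 0 (n-1) (by omega) (by omega)
    have b2 := S.bdd y hy (n-1) 0 (by omega) (by omega)
    have t1 : 0 < p - 1 → (y 0 < y (p-1) ∧ y (p-1) < y p) ∨ (y p < y (p-1) ∧ y (p-1) < y 0) :=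
      fun h => S.tri h (by omega) (by omega) (Or.inl up) y hy
    have t2 : p < n - 1 → (y (p-1) < y p ∧ y p < y (n-1)) ∨ (y (n-1) < y p ∧ y p < y (p-1)) :=
      fun h => S.tri (by omega) h (by omega) (Or.inr un.symm) y hy
    have t3 : y (p-1) ≠ y p := S.inj y hy _ _ (by omega) (by omega) (by omega)
    have hp0 : p - 1 = 0 → y (p-1) = y 0 := fun h => by rw [h]
    have hpn' : p = n - 1 → y (n-1) = y p := fun h => by rw [← h]
    by_cases hlt : y (p-1) < y p
    · left
      have r0 : ∀ i, i ≤ p - 1 → y i = y 0 + i := by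
        rcases R0.1 y hy with h | h
        · intro i hi; have := h i (by omega) hi; simpa using this
        · intro i hi
          have a1 := h i (by omega) hi
          have a2 := h (p-1) (by omega) le_rfl
          push_cast at *
          omega
      have r1 : ∀ i, p ≤ i → i ≤ n - 1 → y i = y p + (i - p) := by
        rcases R1.1 y hy with h | h
        · exact h
        · intro i hi hi2
          have a1 := h i hi hi2
          have a2 := h (n-1) (by omega) le_rfl
          push_cast at *
          omega
      have e1 := r0 (p-1) le_rfl
      have e2 := r1 (n-1) (by omega) le_rfl
      intro i _ hi
      by_cases hip : i ≤ p - 1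
      · have := r0 i hip; push_cast; omega
      · have := r1 i (by omega) hi; push_cast; omega
    · right
      have r0 : ∀ i, i ≤ p - 1 → y i = y 0 - i := by
        rcases R0.1 y hy with h | h
        · intro i hi
          have a1 := h i (by omega) hi
          have a2 := h (p-1) (by omega) le_rfl
          push_cast at *
          omega
        · intro i hi; have := h i (by omega) hi; simpa using this
      have r1 : ∀ i, p ≤ i → i ≤ n - 1 → y i = y p - (i - p) := by
        rcases R1.1 y hy with h | h
        · intro i hi hi2
          have a1 := h i hi hi2
          have a2 := h (n-1) (by omega) le_rfl
          push_cast at *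
          omega
        · exact h
      have e1 := r0 (p-1) le_rfl
      have e2 := r1 (n-1) (by omega) le_rfl
      intro i _ hi
      by_cases hip : i ≤ p - 1
      · have := r0 i hip; push_cast; omega
      · have := r1 i (by omega) hi; push_cast; omega
  · have r0 : ∀ i, i ≤ p - 1 → c i = c 0 := by
      rcases R0.2 c hc with h | h
      · intro i hi; exact h i (by omega) hi
      · intro i hi; exact (h i (by omega) hi).2 (h0 i (by omega))
    have r1 : ∀ i, p ≤ i → i ≤ n - 1 → c i = c p := by
      rcases R1.2 c hc with h | h
      · exact h
      · intro i hi hi2; exact (h i hi hi2).2 (h1 i hi (by omega))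
    by_cases hc0 : c p = c 0
    · left
      intro i _ hi
      by_cases hip : i ≤ p - 1
      · exact r0 i hip
      · rw [r1 i (by omega) hi, hc0]
    · right
      intro i _ hi
      by_cases hip : i ≤ p - 1
      · simp [r0 i hip, h0 i (by omega)]
      · rw [r1 i (by omega) hi, h1 i (by omega) (by omega)]
        simp [hc0, h01]

lemma next_change (n : ℕ) (u : ℕ → ℤ) (s : ℕ) :
    (∀ i, s ≤ i → i < n → u i = u s) ∨
    ∃ e, s < e ∧ e < n ∧ (∀ i, s ≤ i → i < e → u i = u s) ∧ u e ≠ u s := by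
  classical
  by_cases h : ∃ e, s ≤ e ∧ e < n ∧ u e ≠ u s
  · right
    refine ⟨Nat.find h, ?_, (Nat.find_spec h).2.1, ?_, (Nat.find_spec h).2.2⟩
    · rcases Nat.lt_or_ge s (Nat.find h) with h1 | h1
      · exact h1
      · exfalso
        have h2 := Nat.find_spec h
        have : Nat.find h = s := by omega
        rw [this] at h2
        exact h2.2.2 rfl
    · intro i h1 h2
      by_contra h3
      exact Nat.find_min h h2 ⟨h1, by have := (Nat.find_spec h).2.1; omega, h3⟩
  · left
    push Not at h
    exact h

theorem Sys.main (S : Sys n u A B) (hn : 3 ≤ n)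
    (hne : ∃ i, i < n ∧ u i ≠ u 0)
    (hbad : ∀ a k, (a = 0 ∨ a = 1) → 1 ≤ k → k ≤ n - 1 →
      ¬ ∀ i, i < n → (u i = a ↔ (i + 1 ≤ k - 1 ∨ i + 1 = k + 1))) :
    Rig u A B 0 (n-1) := by
  have two : ∀ i j k, u i ≠ u j → u j ≠ u k → u k = u i := by
    intro i j k h1 h2
    have := S.u01 i
    have := S.u01 j
    have := S.u01 k
    omega
  have ext : ∀ p q, q < n → (Rig u A B p q) → (∃ j k, p < j ∧ j ≤ q ∧ p < k ∧ k ≤ q ∧ u j ≠ u k) →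
      (∃ j k, p ≤ j ∧ j < q ∧ p ≤ k ∧ k < q ∧ u j ≠ u k) → Rig u A B 0 (n-1) := by
    rintro p q hq R ⟨j, k, a1, a2, a3, a4, a5⟩ ⟨j', k', b1, b2, b3, b4, b5⟩
    have := S.u01 j
    have := S.u01 k
    have := S.u01 j'
    have := S.u01 k'
    apply R.extAll S hq
    · rcases S.u01 j with h | h
      · exact ⟨j, a1, a2, h⟩
      · exact ⟨k, a3, a4, by omega⟩
    · rcases S.u01 j with h | h
      · exact ⟨k, a3, a4, by omega⟩
      · exact ⟨j, a1, a2, h⟩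
    · rcases S.u01 j' with h | h
      · exact ⟨j', b1, b2, h⟩
      · exact ⟨k', b3, b4, by omega⟩
    · rcases S.u01 j' with h | h
      · exact ⟨k', b3, b4, by omega⟩
      · exact ⟨j', b1, b2, h⟩
  have useA : ∀ s e, 0 < s → s + 2 ≤ e → e < n → u (s-1) ≠ u s → (∀ i, s ≤ i → i < e → u i = u s) →
      u e ≠ u s → Rig u A B 0 (n-1) := by
    intro s e hs hse he h1 h2 h3
    obtain ⟨s, rfl⟩ : ∃ s', s = s' + 1 := ⟨s-1, by omega⟩
    simp only [Nat.add_sub_cancel] at h1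
    have R := S.winA (p := s) (r := e) (by omega) he (fun i a b => h2 i a (by omega)) h1 h3
    exact ext s e he R ⟨e, s+1, by omega, by omega, by omega, by omega, h3⟩
      ⟨s, s+1, by omega, by omega, by omega, by omega, h1⟩
  rcases next_change n u 0 with h | ⟨p1, hp1, hp1n, c1, d1⟩
  · obtain ⟨i, hi, hi2⟩ := hne
    exact absurd (h i (by omega) hi) hi2
  rcases next_change n u p1 with h | ⟨p2, hp2, hp2n, c2, d2⟩
  · exact S.twoBlock hn hp1 hp1n (fun i hi => c1 i (by omega) hi) h d1
  have e1 := c1 (p1-1) (by omega) (by omega)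
  by_cases g2 : p1 + 2 ≤ p2
  · exact useA p1 p2 hp1 g2 hp2n (by rw [e1]; exact d1.symm) c2 d2
  obtain rfl : p2 = p1 + 1 := by omega
  have f2 : u (p1+1) = u 0 := two 0 p1 (p1+1) d1.symm d2.symm
  rcases next_change n u (p1+1) with h | ⟨p3, hp3, hp3n, c3, d3⟩
  · by_cases k1 : p1 = 1
    · exfalso
      subst k1
      refine hbad (u 1) 1 (S.u01 1) le_rfl (by omega) fun i hi => ?_
      rcases (by omega : i = 0 ∨ i = 1 ∨ 2 ≤ i) with rfl | rfl | h5
      · simp [d1.symm]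
      · simp
      · rw [h i h5 hi]
        simp only [d2, false_iff]
        omega
    by_cases k2 : n = p1 + 2
    · exfalso
      refine hbad (u 0) (n-1) (S.u01 0) (by omega) (by omega) fun i hi => ?_
      rcases (by omega : i < p1 ∨ i = p1 ∨ i = p1 + 1) with h5 | rfl | rfl
      · simp only [c1 i (by omega) h5, true_iff]; omega
      · simp only [d1, false_iff]; omega
      · simp only [f2, true_iff]; omega
    obtain ⟨p, rfl⟩ : ∃ p, p1 = p + 2 := ⟨p1-2, by omega⟩
    have v0 := c1 p (by omega) (by omega)
    have v1 := c1 (p+1) (by omega) (by omega)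
    have v4 := h (p+4) (by omega) (by omega)
    simp only [Nat.add_assoc, Nat.reduceAdd] at *
    have R := S.winB (p := p) (by omega) (by rw [v0, v1]) (by rw [v0]; exact d1)
      (by rw [v0, f2]) (by rw [v4, f2, v0])
    exact ext p (p+4) (by omega) R
      ⟨p+2, p+3, by omega, by omega, by omega, by omega, d2.symm⟩
      ⟨p+2, p+3, by omega, by omega, by omega, by omega, d2.symm⟩
  by_cases g3 : p1 + 1 + 2 ≤ p3
  · exact useA (p1+1) p3 (by omega) g3 hp3n (by simpa using d2.symm) c3 d3
  obtain rfl : p3 = p1 + 1 + 1 := by omega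
  simp only [Nat.add_assoc, Nat.reduceAdd] at *
  rcases next_change n u (p1+2) with h | ⟨p4, hp4, hp4n, c4, d4⟩
  · exfalso
    refine hbad (u 0) (p1+1) (S.u01 0) (by omega) (by omega) fun i hi => ?_
    rcases (by omega : i < p1 ∨ i = p1 ∨ i = p1 + 1 ∨ p1 + 2 ≤ i) with h5 | rfl | rfl | h5
    · simp only [c1 i (by omega) h5, true_iff]; omega
    · simp only [d1, false_iff]; omega
    · exact iff_of_true f2 (Or.inr rfl)
    · rw [h i h5 hi]
      rw [f2] at d3
      simp only [d3, false_iff]; omega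
  by_cases g4 : p1 + 2 + 2 ≤ p4
  · exact useA (p1+2) p4 (by omega) g4 hp4n (by simpa using d3.symm) c4 d4
  obtain rfl : p4 = p1 + 2 + 1 := by omega
  obtain ⟨p, rfl⟩ : ∃ p, p1 = p + 1 := ⟨p1-1, (Nat.sub_add_cancel hp1).symm⟩
  simp only [Nat.add_assoc, Nat.reduceAdd, Nat.add_sub_cancel] at *
  have f4 := two _ _ _ d3.symm d4.symm
  have R := S.winC (p := p) (by omega) (by rw [e1]; exact d1) (by rw [e1, f2])
    (by rw [e1, ← f2]; exact d3) (by rw [f4, f2, e1])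
  exact ext p (p+4) (by omega) R
      ⟨p+2, p+3, by omega, by omega, by omega, by omega, d3.symm⟩
      ⟨p+2, p+3, by omega, by omega, by omega, by omega, d3.symm⟩

end core2

section geom

def PC (n : ℕ) : Set (Matrix (Fin n) (Fin n) ℝ) :=
  {X | ∃ (lam : Equiv.Perm (Fin n) → ℝ) (mu : Finset (Fin n) → ℝ),
    (∀ s, 0 ≤ lam s) ∧ ∑ s, lam s = 1 ∧ (∀ V, 0 ≤ mu V) ∧
    X = ∑ s, lam s • Mperm s + ∑ V, mu V • mmap (chi V)}

lemma Mperm_apply {n : ℕ} (s : Equiv.Perm (Fin n)) (k l : Fin n) :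
    Mperm s k l = |((s k : ℕ) : ℝ) - ((s l : ℕ) : ℝ)| := by
  simp [Mperm, mmap, permVec]

lemma cut_apply {n : ℕ} (V : Finset (Fin n)) (k l : Fin n) :
    mmap (chi V) k l = if (k ∈ V ↔ l ∈ V) then 0 else 1 := by
  simp only [mmap, chi]
  by_cases h1 : k ∈ V <;> by_cases h2 : l ∈ V <;> simp [h1, h2]

lemma PC_perm {n : ℕ} (s : Equiv.Perm (Fin n)) : Mperm s ∈ PC n := by
  classical
  refine ⟨fun r => if r = s then 1 else 0, fun _ => 0, ?_, by simp, by simp, by simp⟩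
  intro r; dsimp only; split_ifs <;> norm_num

lemma PC_add_cut {n : ℕ} {X : Matrix (Fin n) (Fin n) ℝ} (hX : X ∈ PC n) (V : Finset (Fin n))
    {r : ℝ} (hr : 0 ≤ r) : X + r • mmap (chi V) ∈ PC n := by
  classical
  obtain ⟨lam, mu, h1, h2, h3, rfl⟩ := hX
  refine ⟨lam, fun W => mu W + if W = V then r else 0, h1, h2, ?_, ?_⟩
  · intro W; have := h3 W; dsimp only; split_ifs <;> linarith
  · simp [add_smul, Finset.sum_add_distrib, add_assoc]

lemma PC_add_cuts {n : ℕ} {X : Matrix (Fin n) (Fin n) ℝ} (hX : X ∈ PC n) (s : Finset ℕ)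
    (V : ℕ → Finset (Fin n)) (r : ℕ → ℝ) (hr : ∀ i ∈ s, 0 ≤ r i) :
    X + ∑ i ∈ s, r i • mmap (chi (V i)) ∈ PC n := by
  classical
  induction s using Finset.induction_on with
  | empty => simpa using hX
  | insert a s ha ih =>
    rw [Finset.sum_insert ha, add_comm (r a • _), ← add_assoc]
    exact PC_add_cut (ih fun i hi => hr i (Finset.mem_insert_of_mem hi)) _
      (hr a (Finset.mem_insert_self _ _))

lemma PC_convex (n : ℕ) : Convex ℝ (PC n) := by
  rintro _ ⟨l1, m1, h1, h2, h3, rfl⟩ _ ⟨l2, m2, g1, g2, g3, rfl⟩ a b ha hb hab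
  refine ⟨fun s => a * l1 s + b * l2 s, fun V => a * m1 V + b * m2 V, ?_, ?_, ?_, ?_⟩
  · intro s; have := h1 s; have := g1 s; positivity
  · rw [Finset.sum_add_distrib, ← Finset.mul_sum, ← Finset.mul_sum, h2, g2]; linarith
  · intro s; have := h3 s; have := g3 s; positivity
  · simp only [add_smul, Finset.sum_add_distrib, smul_add, Finset.smul_sum, mul_smul]
    abel

lemma telescope (z : ℕ → ℝ) (p : ℕ) : ∀ q, p ≤ q →
    ∑ i ∈ Finset.Ico p q, (z (i+1) - z i - 1) = z q - z p - ((q:ℝ) - p) := by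
  intro q hpq
  induction q, hpq using Nat.le_induction with
  | base => simp
  | succ q hpq ih =>
    rw [Finset.sum_Ico_succ_top hpq, ih]; push_cast; ring

lemma Ebn_subset (n : ℕ) : Ebn n ⊆ PC n := by
  classical
  rintro _ ⟨x, hx, rfl⟩
  let τ : Equiv.Perm (Fin n) := Tuple.sort x
  have hm : Monotone (x ∘ τ) := Tuple.monotone_sort x
  let z : ℕ → ℝ := fun i => if h : i < n then x (τ ⟨i, h⟩) else 0
  have hz : ∀ k, z (τ.symm k : ℕ) = x k := by
    intro k; simp [z]
  have hgap : ∀ i ∈ Finset.range (n-1), 0 ≤ z (i+1) - z i - 1 := by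
    intro i hi
    rw [Finset.mem_range] at hi
    have h1 : i < n := by omega
    have h2 : i + 1 < n := by omega
    simp only [z, h1, h2, dif_pos]
    have h3 := hm (show (⟨i, h1⟩ : Fin n) ≤ ⟨i+1, h2⟩ by simp)
    have h4 := hx (τ ⟨i+1, h2⟩) (τ ⟨i, h1⟩) (by simp)
    simp only [Function.comp] at h3
    rw [abs_of_nonneg (by linarith)] at h4
    linarith
  have key := PC_add_cuts (PC_perm τ.symm) (Finset.range (n-1))
    (fun i => Finset.univ.filter fun k => (τ.symm k : ℕ) ≤ i) (fun i => z (i+1) - z i - 1) hgap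
  convert key using 1
  have main : ∀ k l : Fin n, (τ.symm k : ℕ) ≤ τ.symm l → |x k - x l| =
      |((τ.symm k : ℕ) : ℝ) - ((τ.symm l : ℕ) : ℝ)| + ∑ i ∈ Finset.range (n-1),
      (z (i+1) - z i - 1) * (if ((τ.symm k : ℕ) ≤ i ↔ (τ.symm l : ℕ) ≤ i) then (0:ℝ) else 1) := by
    intro k l hkl
    have e : ∑ i ∈ Finset.range (n-1),
      (z (i+1) - z i - 1) * (if ((τ.symm k : ℕ) ≤ i ↔ (τ.symm l : ℕ) ≤ i) then (0:ℝ) else 1) =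
      ∑ i ∈ Finset.Ico (τ.symm k : ℕ) (τ.symm l : ℕ), (z (i+1) - z i - 1) := by
      simp only [mul_ite, mul_zero, mul_one]
      rw [Finset.sum_ite, Finset.sum_const_zero, zero_add]
      apply Finset.sum_congr _ (fun _ _ => rfl)
      ext i
      have := (τ.symm l).2
      simp only [Finset.mem_filter, Finset.mem_range, Finset.mem_Ico]
      omega
    rw [e, telescope z _ _ hkl, hz, hz]
    have h1 : x k ≤ x l := by
      have := hm (show τ.symm k ≤ τ.symm l from hkl)
      simpa using this
    have h2 : ((τ.symm k : ℕ) : ℝ) ≤ ((τ.symm l : ℕ) : ℝ) := by exact_mod_cast hkl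
    rw [abs_of_nonpos (by linarith), abs_of_nonpos (by linarith)]
    ring
  ext k l
  simp only [Matrix.add_apply, Matrix.sum_apply, Matrix.smul_apply, cut_apply, Mperm_apply,
    smul_eq_mul, Finset.mem_filter, Finset.mem_univ, true_and]
  simp only [mmap]
  rcases le_total (τ.symm k : ℕ) (τ.symm l : ℕ) with h | h
  · exact main k l h
  · rw [abs_sub_comm, main l k h, abs_sub_comm]
    congr 1
    apply Finset.sum_congr rfl
    intro i _
    congr 1
    simp only [iff_comm]

lemma PC_closed (n : ℕ) : IsClosed (PC n) := by
  classical
  rw [← closure_subset_iff_isClosed]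
  intro x hx
  obtain ⟨R, hR⟩ : ∃ R : ℝ, ∀ k l, x k l < R := by
    refine ⟨∑ k, ∑ l, |x k l| + 1, fun k l => ?_⟩
    have h1 : |x k l| ≤ ∑ l, |x k l| :=
      Finset.single_le_sum (f := fun l => |x k l|) (fun _ _ => abs_nonneg _) (Finset.mem_univ l)
    have h2 : ∑ l, |x k l| ≤ ∑ k, ∑ l, |x k l| :=
      Finset.single_le_sum (f := fun k => ∑ l, |x k l|)
        (fun _ _ => Finset.sum_nonneg fun _ _ => abs_nonneg _) (Finset.mem_univ k)
    have := le_abs_self (x k l)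
    linarith
  let O : Set (Matrix (Fin n) (Fin n) ℝ) := {X | ∀ k l, X k l < R}
  have hO : IsOpen O := by
    have : O = ⋂ k, ⋂ l, {X : Matrix (Fin n) (Fin n) ℝ | X k l < R} := by
      ext X; simp [O]
    rw [this]
    refine isOpen_iInter_of_finite fun k => isOpen_iInter_of_finite fun l => ?_
    exact isOpen_lt (continuous_id.matrix_elem k l) continuous_const
  let K : Set ((Equiv.Perm (Fin n) → ℝ) × (Finset (Fin n) → ℝ)) :=
    stdSimplex ℝ (Equiv.Perm (Fin n)) ×ˢ Set.Icc (fun _ => 0) (fun _ => max R 0)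
  have hK : IsCompact K := (isCompact_stdSimplex ℝ _).prod isCompact_Icc
  let Φ : ((Equiv.Perm (Fin n) → ℝ) × (Finset (Fin n) → ℝ)) → Matrix (Fin n) (Fin n) ℝ :=
    fun p => ∑ s, p.1 s • Mperm s + ∑ V, p.2 V • mmap (chi V)
  have hΦ : Continuous Φ := by
    refine Continuous.add ?_ ?_
    · exact continuous_finset_sum _ fun s _ =>
        ((continuous_apply s).comp continuous_fst).smul continuous_const
    · exact continuous_finset_sum _ fun s _ =>
        ((continuous_apply s).comp continuous_snd).smul continuous_const
  have hcl : IsClosed (Φ '' K) := (hK.image hΦ).isClosed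
  have hsub : O ∩ PC n ⊆ Φ '' K := by
    rintro X ⟨hXO, lam, mu, h1, h2, h3, rfl⟩
    refine ⟨(lam, fun V => if mmap (chi V) = 0 then 0 else mu V), ⟨⟨h1, h2⟩, ?_, ?_⟩, ?_⟩
    · intro V; dsimp only; split_ifs
      · exact le_rfl
      · exact h3 V
    · intro V; dsimp only; split_ifs with hV
      · exact le_max_right _ _
      · refine le_trans ?_ (le_max_left _ _)
        obtain ⟨k, l, hkl⟩ : ∃ k l, mmap (chi V) k l ≠ 0 := by
          by_contra hcon
          push Not at hcon
          exact hV (by ext k l; simpa using hcon k l)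
        have hkl1 : mmap (chi V) k l = 1 := by
          rw [cut_apply] at hkl ⊢
          split_ifs at hkl ⊢ <;> simp_all
        refine le_trans ?_ (hXO k l).le
        simp only [Matrix.add_apply, Matrix.sum_apply, Matrix.smul_apply, smul_eq_mul]
        have a1 : 0 ≤ ∑ s, lam s * Mperm s k l := Finset.sum_nonneg fun s _ =>
          mul_nonneg (h1 s) (by rw [Mperm_apply]; exact abs_nonneg _)
        have a2 : mu V * mmap (chi V) k l ≤ ∑ V, mu V * mmap (chi V) k l :=
          Finset.single_le_sum (f := fun V => mu V * mmap (chi V) k l)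
            (fun W _ => mul_nonneg (h3 W) (abs_nonneg _)) (Finset.mem_univ V)
        rw [hkl1, mul_one] at a2
        linarith
    · simp only [Φ]
      congr 1
      refine Finset.sum_congr rfl fun V _ => ?_
      split_ifs with hV
      · rw [hV]; simp
      · rfl
  have h1 : x ∈ closure (O ∩ PC n) := hO.inter_closure ⟨hR, hx⟩
  have h2 : x ∈ Φ '' K := hcl.closure_subset_iff.2 hsub h1
  obtain ⟨⟨lam, mu⟩, ⟨⟨h3, h4⟩, h5, h6⟩, rfl⟩ := h2
  exact ⟨lam, mu, h3, h4, h5, rfl⟩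

lemma closureQ_subset (n : ℕ) : closure (Qn n) ⊆ PC n :=
  (PC_closed n).closure_subset_iff.2 (convexHull_min (Ebn_subset n) (PC_convex n))

lemma Mperm_mem (n : ℕ) (s : Equiv.Perm (Fin n)) : Mperm s ∈ Ebn n := by
  refine ⟨permVec s, fun k l hkl => ?_, rfl⟩
  have h1 : ((s k : ℕ) : ℤ) ≠ (s l : ℕ) := by
    intro h; apply hkl; apply s.injective; apply Fin.ext; exact_mod_cast h
  have h2 : (1:ℤ) ≤ |((s k : ℕ) : ℤ) - (s l : ℕ)| := Int.one_le_abs (sub_ne_zero.2 h1)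
  simp only [permVec, add_sub_add_right_eq_sub]
  exact_mod_cast h2

lemma ray_mem (n : ℕ) (s : Equiv.Perm (Fin n)) (U : Finset (Fin n)) (t : ℝ) (ht : 0 ≤ t) :
    Mperm s + t • mmap (chi U) ∈ closure (Qn n) := by
  rcases ht.eq_or_lt with rfl | ht
  · rw [zero_smul, add_zero]; exact subset_closure (subset_convexHull ℝ _ (Mperm_mem n s))
  have hb : ∀ k l : Fin n, |permVec s k - permVec s l| ≤ (n:ℝ) - 1 := by
    intro k l
    have h1 : ((s k : ℕ) : ℝ) + 1 ≤ n := by exact_mod_cast (s k).2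
    have h2 : ((s l : ℕ) : ℝ) + 1 ≤ n := by exact_mod_cast (s l).2
    have h3 : (0:ℝ) ≤ ((s k : ℕ) : ℝ) := by positivity
    have h4 : (0:ℝ) ≤ ((s l : ℕ) : ℝ) := by positivity
    simp only [permVec]
    rw [abs_le]; constructor <;> linarith
  obtain ⟨N, hN⟩ : ∃ N : Matrix (Fin n) (Fin n) ℝ, ∀ r : ℝ, (n:ℝ) ≤ r →
      N + r • mmap (chi U) ∈ Ebn n := by
    refine ⟨Matrix.of fun k l => if k ∈ U then (if l ∈ U then |permVec s k - permVec s l| else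
      permVec s k - permVec s l) else (if l ∈ U then permVec s l - permVec s k else
      |permVec s k - permVec s l|), fun r hr => ⟨fun k => permVec s k + r * chi U k, ?_, ?_⟩⟩
    · intro k l hkl
      obtain ⟨x, hx, hx2⟩ := Mperm_mem n s
      have h1 : 1 ≤ |permVec s k - permVec s l| := by
        have := hx k l hkl
        have h3 : Mperm s k l = |x k - x l| := by rw [hx2]; rfl
        rw [← h3] at this
        exact this
      have h2 := abs_le.1 (hb k l)
      by_cases hk : k ∈ U <;> by_cases hl : l ∈ U <;> simp only [chi, hk, hl, if_true, if_false]
      · simpa using h1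
      · refine le_trans ?_ (le_abs_self _); linarith
      · refine le_trans ?_ (neg_le_abs _); linarith
      · simpa using h1
    · ext k l
      simp only [Matrix.add_apply, Matrix.smul_apply, cut_apply, smul_eq_mul, Matrix.of_apply]
      have h2 := abs_le.1 (hb k l)
      by_cases hk : k ∈ U <;> by_cases hl : l ∈ U <;> simp only [mmap, chi, hk, hl, if_true, if_false]
      · simp
      · rw [abs_of_nonneg (by linarith)]; simp; ring
      · rw [abs_of_nonpos (by linarith)]; simp; ring
      · simp
  have hlim : Filter.Tendsto (fun e : ℝ => (1 - e) • Mperm s + e • N + t • mmap (chi U))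
      (nhdsWithin 0 (Set.Ioi 0)) (nhds (Mperm s + t • mmap (chi U))) := by
    have : Continuous (fun e : ℝ => (1 - e) • Mperm s + e • N + t • mmap (chi U)) := by
      refine Continuous.add (Continuous.add ?_ ?_) continuous_const
      · exact (continuous_const.sub continuous_id).smul continuous_const
      · exact continuous_id.smul continuous_const
    have h := this.tendsto 0
    simp only [sub_zero, one_smul, zero_smul, add_zero] at h
    exact h.mono_left nhdsWithin_le_nhds
  refine mem_closure_of_tendsto hlim ?_
  have hpos : 0 < min 1 (t / (n + 1)) := by positivity
  filter_upwards [Ioo_mem_nhdsGT hpos] with e he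
  have he0 := he.1
  have he1 : e < 1 := lt_of_lt_of_le he.2 (min_le_left _ _)
  have he2 : e < t / (n+1) := lt_of_lt_of_le he.2 (min_le_right _ _)
  have hn : (n:ℝ) ≤ t / e := by
    rw [le_div_iff₀ he0]
    rw [lt_div_iff₀ (by positivity)] at he2
    nlinarith
  have := (convex_convexHull ℝ (Ebn n)) (subset_convexHull ℝ _ (Mperm_mem n s))
    (subset_convexHull ℝ _ (hN (t / e) hn)) (by linarith : 0 ≤ 1 - e) he0.le (by ring)
  rw [smul_add, smul_smul, mul_div_cancel₀ _ he0.ne', ← add_assoc] at this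
  exact this

lemma cut_compl {n : ℕ} (U : Finset (Fin n)) : mmap (chi Uᶜ) = mmap (chi U) := by
  ext k l
  simp only [cut_apply, Finset.mem_compl, not_iff_not]

lemma not_extreme {n : ℕ} (hn : 3 ≤ n) (π : Equiv.Perm (Fin n)) (V : Finset (Fin n))
    (hV : overRidge π V) : ¬ IsExtreme ℝ (closure (Qn n)) (halfline π V) := by
  classical
  intro hE
  obtain ⟨k, hk1, hk2, hVk⟩ := hV
  let a0 : Fin n := ⟨k-1, by omega⟩
  let b0 : Fin n := ⟨k, by omega⟩
  let π' : Equiv.Perm (Fin n) := π.trans (Equiv.swap a0 b0)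
  let W : Finset (Fin n) := Finset.univ.filter fun j => (π j : ℕ) + 1 ≤ k
  have hW : ∀ j, j ∈ W ↔ (π j : ℕ) + 1 ≤ k := by intro j; simp [W]
  have hπ' : ∀ j, (π' j : ℕ) = if (π j : ℕ) = k - 1 then k else if (π j : ℕ) = k then k - 1
      else π j := by
    intro j
    simp only [π', Equiv.trans_apply, Equiv.swap_apply_def, Fin.ext_iff, a0, b0]
    split_ifs <;> rfl
  have hsum : Mperm π + mmap (chi V) = Mperm π' + mmap (chi W) := by
    ext i j
    simp only [Matrix.add_apply, Mperm_apply, cut_apply, hVk, hW]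
    rw [hπ' i, hπ' j]
    generalize (π i : ℕ) = x
    generalize (π j : ℕ) = y
    have : |(x:ℤ) - y| + (if (x + 1 ≤ k - 1 ∨ x + 1 = k + 1 ↔ y + 1 ≤ k - 1 ∨ y + 1 = k + 1)
      then 0 else 1) = |(((if x = k - 1 then k else if x = k then k - 1 else x : ℕ)) : ℤ) -
        ((if y = k - 1 then k else if y = k then k - 1 else y : ℕ) : ℤ)| +
        (if (x + 1 ≤ k ↔ y + 1 ≤ k) then 0 else 1) := by
      rw [← Int.natCast_natAbs, ← Int.natCast_natAbs]
      split_ifs <;> omega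
    exact_mod_cast this
  have hin : Mperm π + (1:ℝ) • mmap (chi V) ∈ halfline π V := ⟨1, zero_le_one, rfl⟩
  have h0 : Mperm π' ∈ closure (Qn n) := subset_closure (subset_convexHull ℝ _ (Mperm_mem n π'))
  have h2 := ray_mem n π' W 2 (by norm_num)
  have hseg : Mperm π + (1:ℝ) • mmap (chi V) ∈
      openSegment ℝ (Mperm π') (Mperm π' + (2:ℝ) • mmap (chi W)) := by
    refine ⟨1/2, 1/2, by norm_num, by norm_num, by norm_num, ?_⟩
    rw [one_smul, hsum]
    ext i j
    simp only [Matrix.add_apply, Matrix.smul_apply, smul_eq_mul]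
    ring
  obtain ⟨t, ht, hteq⟩ := hE.2 h0 h2 hin hseg
  have hent : ∀ i j, mmap (chi V) i j - mmap (chi W) i j = t * mmap (chi V) i j := by
    intro i j
    have e1 := congrFun (congrFun hsum i) j
    have e2 := congrFun (congrFun hteq i) j
    simp only [Matrix.add_apply, Matrix.smul_apply, smul_eq_mul] at e1 e2
    linarith
  let a := π.symm a0
  let b := π.symm b0
  have ha : (π a : ℕ) = k - 1 := by simp [a, a0]
  have hb : (π b : ℕ) = k := by simp [b, b0]
  have hab := hent a b
  have v1 : mmap (chi V) a b = 1 := by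
      rw [cut_apply, if_neg]; rw [hVk, hVk, ha, hb]; omega
  have v2 : mmap (chi W) a b = 1 := by
      rw [cut_apply, if_neg]; rw [hW, hW, ha, hb]; omega
  rw [v1, v2] at hab
  have ht0 : t = 0 := by linarith
  subst ht0
  by_cases hk : k = 1
  · have hc : (π (π.symm ⟨k+1, by omega⟩) : ℕ) = k + 1 := by simp
    have := hent b (π.symm ⟨k+1, by omega⟩)
    have w1 : mmap (chi V) b (π.symm ⟨k+1, by omega⟩) = 1 := by
      rw [cut_apply, if_neg]; rw [hVk, hVk, hb, hc]; omega
    have w2 : mmap (chi W) b (π.symm ⟨k+1, by omega⟩) = 0 := by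
      rw [cut_apply, if_pos]; rw [hW, hW, hb, hc]; omega
    rw [w1, w2] at this
    norm_num at this
  · have hc : (π (π.symm ⟨k-2, by omega⟩) : ℕ) = k - 2 := by simp
    have := hent a (π.symm ⟨k-2, by omega⟩)
    have w1 : mmap (chi V) a (π.symm ⟨k-2, by omega⟩) = 1 := by
      rw [cut_apply, if_neg]; rw [hVk, hVk, ha, hc]; omega
    have w2 : mmap (chi W) a (π.symm ⟨k-2, by omega⟩) = 0 := by
      rw [cut_apply, if_pos]; rw [hW, hW, ha, hc]; omega
    rw [w1, w2] at this
    norm_num at this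

end geom

section final

noncomputable def yv {n : ℕ} (π s : Equiv.Perm (Fin n)) : ℕ → ℤ :=
  fun i => if h : i < n then ((s (π.symm ⟨i, h⟩) : ℕ) : ℤ) else 0

open Classical in
noncomputable def cv {n : ℕ} (π : Equiv.Perm (Fin n)) (V : Finset (Fin n)) : ℕ → ℤ :=
  fun i => if ∃ h : i < n, π.symm ⟨i, h⟩ ∈ V then 1 else 0

noncomputable def entryL {n : ℕ} (π : Equiv.Perm (Fin n)) (i j : ℕ) :
    Matrix (Fin n) (Fin n) ℝ →ₗ[ℝ] ℝ :=
  if h : i < n ∧ j < n then Matrix.entryLinearMap ℝ ℝ (π.symm ⟨i, h.1⟩) (π.symm ⟨j, h.2⟩) else 0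

noncomputable def EL {n : ℕ} (π : Equiv.Perm (Fin n)) (L : List (ℤ × ℕ × ℕ)) :
    Matrix (Fin n) (Fin n) ℝ →ₗ[ℝ] ℝ :=
  (L.map fun e => (e.1 : ℝ) • entryL π e.2.1 e.2.2).sum

lemma EL_spec {n : ℕ} (π : Equiv.Perm (Fin n)) (X : Matrix (Fin n) (Fin n) ℝ) (y : ℕ → ℤ)
    (hX : ∀ i j (hi : i < n) (hj : j < n),
      X (π.symm ⟨i, hi⟩) (π.symm ⟨j, hj⟩) = ((dd y i j : ℤ) : ℝ))
    (L : List (ℤ × ℕ × ℕ)) (hL : ∀ e ∈ L, e.2.1 < n ∧ e.2.2 < n) :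
    EL π L X = ((ev L y : ℤ) : ℝ) := by
  induction L with
  | nil => simp [EL, ev]
  | cons e L ih =>
    have h1 := ih fun e' he' => hL e' (List.mem_cons_of_mem _ he')
    have h2 := hL e List.mem_cons_self
    have h3 : EL π (e :: L) X = (e.1 : ℝ) * entryL π e.2.1 e.2.2 X + EL π L X := by
      simp [EL]
    have h4 : ev (e :: L) y = e.1 * dd y e.2.1 e.2.2 + ev L y := by simp [ev]
    rw [h3, h4, h1, entryL, dif_pos h2, Matrix.entryLinearMap_apply, hX]
    push_cast
    rfl

lemma perm_dd {n : ℕ} (π s : Equiv.Perm (Fin n)) (i j : ℕ) (hi : i < n) (hj : j < n) :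
    Mperm s (π.symm ⟨i, hi⟩) (π.symm ⟨j, hj⟩) = ((dd (yv π s) i j : ℤ) : ℝ) := by
  rw [Mperm_apply]
  simp only [dd, yv, dif_pos hi, dif_pos hj, Int.natCast_natAbs]
  push_cast
  rfl

lemma self_dd {n : ℕ} (π : Equiv.Perm (Fin n)) (i j : ℕ) (hi : i < n) (hj : j < n) :
    Mperm π (π.symm ⟨i, hi⟩) (π.symm ⟨j, hj⟩) = ((dd idz i j : ℤ) : ℝ) := by
  rw [Mperm_apply]
  simp only [dd, idz, Equiv.apply_symm_apply, Int.natCast_natAbs]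
  push_cast
  rfl

lemma cv_eq {n : ℕ} (π : Equiv.Perm (Fin n)) (V : Finset (Fin n)) (i : ℕ) (hi : i < n) :
    cv π V i = if π.symm ⟨i, hi⟩ ∈ V then 1 else 0 := by
  simp [cv, hi]

lemma cut_dd {n : ℕ} (π : Equiv.Perm (Fin n)) (V : Finset (Fin n)) (i j : ℕ) (hi : i < n)
    (hj : j < n) :
    mmap (chi V) (π.symm ⟨i, hi⟩) (π.symm ⟨j, hj⟩) = ((dd (cv π V) i j : ℤ) : ℝ) := by
  rw [cut_apply]
  simp only [dd, cv_eq π V _ hi, cv_eq π V _ hj]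
  by_cases h1 : π.symm ⟨i, hi⟩ ∈ V <;> by_cases h2 : π.symm ⟨j, hj⟩ ∈ V <;> simp [h1, h2]

lemma cv01 {n : ℕ} (π : Equiv.Perm (Fin n)) (V : Finset (Fin n)) (i : ℕ) :
    cv π V i = 0 ∨ cv π V i = 1 := by
  unfold cv; split_ifs <;> simp

lemma cv_pi {n : ℕ} (π : Equiv.Perm (Fin n)) (V : Finset (Fin n)) (j : Fin n) :
    cv π V (π j : ℕ) = if j ∈ V then 1 else 0 := by
  rw [cv_eq π V _ (π j).2]; simp

lemma yv_pi {n : ℕ} (π s : Equiv.Perm (Fin n)) (j : Fin n) :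
    yv π s (π j : ℕ) = ((s j : ℕ) : ℤ) := by
  simp [yv]

lemma mkSys {n : ℕ} (π : Equiv.Perm (Fin n)) (U : Finset (Fin n))
    (lam : Equiv.Perm (Fin n) → ℝ) (mu : Finset (Fin n) → ℝ) (t : ℝ)
    (h1 : ∀ s, 0 ≤ lam s) (h2 : ∑ s, lam s = 1) (h3 : ∀ V, 0 ≤ mu V)
    (h : Mperm π + t • mmap (chi U) = ∑ s, lam s • Mperm s + ∑ V, mu V • mmap (chi V)) :
    Sys n (cv π U) {y | ∃ s, 0 < lam s ∧ y = yv π s} {c | ∃ V, 0 < mu V ∧ c = cv π V} := by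
  refine ⟨cv01 π U, ?_, ?_, ?_, ?_⟩
  · rintro _ ⟨s, _, rfl⟩ i j hi hj hij h
    simp only [yv, dif_pos hi, dif_pos hj] at h
    have h' : s (π.symm ⟨i, hi⟩) = s (π.symm ⟨j, hj⟩) := Fin.ext (by exact_mod_cast h)
    have := π.symm.injective (s.injective h')
    exact hij (by simpa using this)
  · rintro _ ⟨s, _, rfl⟩ i j hi hj
    simp only [yv, dif_pos hi, dif_pos hj]
    have := (s (π.symm ⟨i, hi⟩)).2
    omega
  · rintro _ ⟨V, _, rfl⟩ i
    exact cv01 π V i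
  · intro L hL hu hA hB
    have hE := congrArg (EL π L) h
    simp only [map_add, map_smul, map_sum, smul_eq_mul] at hE
    rw [EL_spec π _ _ (self_dd π) L hL, EL_spec π _ _ (cut_dd π U) L hL, hu] at hE
    have e1 : ∀ s, EL π L (Mperm s) = ((ev L (yv π s) : ℤ) : ℝ) :=
      fun s => EL_spec π _ _ (perm_dd π s) L hL
    have e2 : ∀ V, EL π L (mmap (chi V)) = ((ev L (cv π V) : ℤ) : ℝ) :=
      fun V => EL_spec π _ _ (cut_dd π V) L hL
    simp only [e1, e2] at hE
    have n1 : ∀ s ∈ Finset.univ,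
        0 ≤ lam s * (((ev L (yv π s) : ℤ) : ℝ) - ((ev L idz : ℤ) : ℝ)) := by
      intro s _
      rcases (h1 s).eq_or_lt with h0 | h0
      · rw [← h0]; simp
      · have := hA _ ⟨s, h0, rfl⟩
        have : ((ev L idz : ℤ) : ℝ) ≤ ((ev L (yv π s) : ℤ) : ℝ) := by exact_mod_cast this
        exact mul_nonneg h0.le (by linarith)
    have n2 : ∀ V ∈ Finset.univ, 0 ≤ mu V * ((ev L (cv π V) : ℤ) : ℝ) := by
      intro V _
      rcases (h3 V).eq_or_lt with h0 | h0
      · rw [← h0]; simp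
      · have := hB _ ⟨V, h0, rfl⟩
        have : (0:ℝ) ≤ ((ev L (cv π V) : ℤ) : ℝ) := by exact_mod_cast this
        exact mul_nonneg h0.le this
    have s1 := Finset.sum_nonneg n1
    have s2 := Finset.sum_nonneg n2
    have s3 : ∑ s, lam s * (((ev L (yv π s) : ℤ) : ℝ) - ((ev L idz : ℤ) : ℝ)) =
        ∑ s, lam s * ((ev L (yv π s) : ℤ) : ℝ) - ((ev L idz : ℤ) : ℝ) := by
      simp only [mul_sub, Finset.sum_sub_distrib, ← Finset.sum_mul, h2, one_mul]
    push_cast at hE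
    have z1 := (Finset.sum_eq_zero_iff_of_nonneg n1).1 (by linarith)
    have z2 := (Finset.sum_eq_zero_iff_of_nonneg n2).1 (by linarith)
    constructor
    · rintro _ ⟨s, hs, rfl⟩
      have := (mul_eq_zero.1 (z1 s (Finset.mem_univ s))).resolve_left hs.ne'
      have : ((ev L (yv π s) : ℤ) : ℝ) = ((ev L idz : ℤ) : ℝ) := by linarith
      exact_mod_cast this
    · rintro _ ⟨V, hV, rfl⟩
      have := (mul_eq_zero.1 (z2 V (Finset.mem_univ V))).resolve_left hV.ne'
      exact_mod_cast this

lemma half_of {n : ℕ} (π : Equiv.Perm (Fin n)) (U : Finset (Fin n))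
    (lam : Equiv.Perm (Fin n) → ℝ) (mu : Finset (Fin n) → ℝ)
    (h1 : ∀ s, 0 ≤ lam s) (h2 : ∑ s, lam s = 1) (h3 : ∀ V, 0 ≤ mu V)
    (hl : ∀ s, 0 < lam s → Mperm s = Mperm π)
    (hm : ∀ V, 0 < mu V → mmap (chi V) = 0 ∨ mmap (chi V) = mmap (chi U)) :
    ∑ s, lam s • Mperm s + ∑ V, mu V • mmap (chi V) ∈ halfline π U := by
  have c : ∀ V, ∃ r : ℝ, 0 ≤ r ∧ mu V • mmap (chi V) = r • mmap (chi U) := by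
    intro V
    rcases (h3 V).eq_or_lt with h0 | h0
    · exact ⟨0, le_rfl, by rw [← h0]; simp⟩
    · rcases hm V h0 with h | h
      · exact ⟨0, le_rfl, by rw [h]; simp⟩
      · exact ⟨mu V, h0.le, by rw [h]⟩
  choose r hr hr2 using c
  refine ⟨∑ V, r V, Finset.sum_nonneg fun V _ => hr V, ?_⟩
  rw [Finset.sum_smul]
  congr 1
  · rw [← one_smul ℝ (Mperm π), ← h2, Finset.sum_smul]
    refine Finset.sum_congr rfl fun s _ => ?_
    rcases (h1 s).eq_or_lt with h0 | h0
    · rw [← h0]; simp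
    · rw [hl s h0]
  · exact Finset.sum_congr rfl fun V _ => hr2 V

lemma rigid {n : ℕ} (hn : 3 ≤ n) (π : Equiv.Perm (Fin n)) (U : Finset (Fin n))
    (hU : U.Nonempty) (hU' : U ≠ Finset.univ) (o1 : ¬ overRidge π U) (o2 : ¬ overRidge π Uᶜ)
    (lam : Equiv.Perm (Fin n) → ℝ) (mu : Finset (Fin n) → ℝ) (t : ℝ)
    (h1 : ∀ s, 0 ≤ lam s) (h2 : ∑ s, lam s = 1) (h3 : ∀ V, 0 ≤ mu V)
    (h : Mperm π + t • mmap (chi U) = ∑ s, lam s • Mperm s + ∑ V, mu V • mmap (chi V)) :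
    (∀ s, 0 < lam s → Mperm s = Mperm π) ∧
    (∀ V, 0 < mu V → mmap (chi V) = 0 ∨ mmap (chi V) = mmap (chi U)) := by
  have S := mkSys π U lam mu t h1 h2 h3 h
  have hne : ∃ i, i < n ∧ cv π U i ≠ cv π U 0 := by
    by_contra hcon
    push Not at hcon
    obtain ⟨a, ha⟩ := hU
    apply hU'
    ext b
    have e1 := hcon (π a) (π a).2
    have e2 := hcon (π b) (π b).2
    rw [← e1, cv_pi, cv_pi, if_pos ha] at e2
    simp only [Finset.mem_univ, iff_true]
    by_contra hb
    rw [if_neg hb] at e2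
    norm_num at e2
  have hbad : ∀ a k, (a = 0 ∨ a = 1) → 1 ≤ k → k ≤ n - 1 →
      ¬ ∀ i, i < n → (cv π U i = a ↔ (i + 1 ≤ k - 1 ∨ i + 1 = k + 1)) := by
    intro a k ha hk1 hk2 hall
    rcases ha with rfl | rfl
    · refine o2 ⟨k, hk1, hk2, fun j => ?_⟩
      rw [← hall (π j) (π j).2, cv_pi, Finset.mem_compl]
      split_ifs with hj <;> simp [hj]
    · refine o1 ⟨k, hk1, hk2, fun j => ?_⟩
      rw [← hall (π j) (π j).2, cv_pi]
      split_ifs with hj <;> simp [hj]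
  have R := S.main hn hne hbad
  constructor
  · intro s hs
    have hR := R.1 _ ⟨s, hs, rfl⟩
    ext k l
    rw [Mperm_apply, Mperm_apply]
    have bk : (π k : ℕ) ≤ n - 1 := by have := (π k).2; omega
    have bl : (π l : ℕ) ≤ n - 1 := by have := (π l).2; omega
    have : |((s k : ℕ) : ℤ) - ((s l : ℕ) : ℤ)| = |((π k : ℕ) : ℤ) - ((π l : ℕ) : ℤ)| := by
      rw [← yv_pi π s k, ← yv_pi π s l]
      rcases hR with hR | hR
      · rw [hR _ (Nat.zero_le _) bk, hR _ (Nat.zero_le _) bl]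
        congr 1; ring
      · rw [hR _ (Nat.zero_le _) bk, hR _ (Nat.zero_le _) bl, abs_sub_comm]
        congr 1; ring
    exact_mod_cast this
  · intro V hV
    have hR := R.2 _ ⟨V, hV, rfl⟩
    have hx : ∀ (W : Finset (Fin n)) (k : Fin n), k ∈ W ↔ cv π W (π k) = 1 := by
      intro W k; rw [cv_pi]; split_ifs with hk <;> simp [hk]
    rcases hR with hR | hR
    · left
      ext k l
      have bk := hR (π k) (Nat.zero_le _) (by have := (π k).2; omega)
      have bl := hR (π l) (Nat.zero_le _) (by have := (π l).2; omega)
      rw [cut_apply, if_pos (by rw [hx, hx, bk, bl])]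
      rfl
    · right
      ext k l
      have bk := hR (π k) (Nat.zero_le _) (by have := (π k).2; omega)
      have bl := hR (π l) (Nat.zero_le _) (by have := (π l).2; omega)
      have a1 := cv01 π V (π k)
      have a2 := cv01 π V (π l)
      have a3 := cv01 π V 0
      have a4 := cv01 π U (π k)
      have a5 := cv01 π U (π l)
      have a6 := cv01 π U 0
      have : (k ∈ V ↔ l ∈ V) ↔ (k ∈ U ↔ l ∈ U) := by
        rw [hx, hx, hx, hx]
        omega
      rw [cut_apply, cut_apply]
      simp only [this]

end final

theorem stmt12 (n : ℕ) (hn : 3 ≤ n) (π : Equiv.Perm (Fin n)) (U : Finset (Fin n))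
    (hU : U.Nonempty) (hU' : U ≠ Finset.univ) :
    IsExtreme ℝ (closure (Qn n)) (halfline π U) ↔
      ¬ overRidge π U ∧ ¬ overRidge π Uᶜ := by
  constructor
  · intro hE
    refine ⟨fun h => not_extreme hn π U h hE, fun h => not_extreme hn π Uᶜ h ?_⟩
    have : halfline π Uᶜ = halfline π U := by simp only [halfline, cut_compl]
    rw [this]; exact hE
  · rintro ⟨o1, o2⟩
    refine ⟨?_, ?_⟩
    · rintro _ ⟨t, ht, rfl⟩
      exact ray_mem n π U t ht
    · rintro x1 hx1 x2 hx2 x ⟨t, ht, rfl⟩ ⟨a, b, ha, hb, hab, heq⟩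
      obtain ⟨l1, m1, p1, p2, p3, rfl⟩ := closureQ_subset n hx1
      obtain ⟨l2, m2, q1, q2, q3, rfl⟩ := closureQ_subset n hx2
      have key := rigid hn π U hU hU' o1 o2 (fun s => a * l1 s + b * l2 s)
        (fun V => a * m1 V + b * m2 V) t
        (fun s => by have := p1 s; have := q1 s; positivity)
        (by rw [Finset.sum_add_distrib, ← Finset.mul_sum, ← Finset.mul_sum, p2, q2]; linarith)
        (fun V => by have := p3 V; have := q3 V; positivity)
        (by
          rw [← heq]
          simp only [add_smul, Finset.sum_add_distrib, smul_add, Finset.smul_sum, mul_smul]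
          abel)
      refine half_of π U l1 m1 p1 p2 p3 (fun s hs => key.1 s ?_) (fun V hV => key.2 V ?_)
      · have := q1 s; positivity
      · have := q3 V; positivity
end

section
/- Let n ≥ 3, let π be a permutation of [n], and let U ⊆ [n] be over the ridge from π. Then the half-line M(π) + ℝ≥0·M(χ^U) = {M(π) + t·M(χ^U) : t ≥ 0} is not an extreme subset of closure(Q_n), i.e., it is not an unbounded edge of the polyhedron closure(Q_n). -/
open scoped BigOperators Pointwise

/-- Stretch the gap between positions `m` and `m+1` to length 2. -/
def stretchF (m a : ℤ) : ℤ := if a ≤ m then a else a + 1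

/-- Same as `stretchF`, after swapping positions `m` and `m+1`. -/
def stretchG (m a : ℤ) : ℤ :=
  if a < m then a else if a = m then m + 2 else if a = m + 1 then m else a + 1

/-- Indicator of the set over the ridge. -/
def ridgeC (m a : ℤ) : ℤ := if a < m ∨ a = m + 1 then 1 else 0

lemma stretch_id (m a b : ℤ) :
    |stretchF m a - stretchF m b| + |stretchG m a - stretchG m b|
      = 2 * |a - b| + 2 * |ridgeC m a - ridgeC m b| := by
  unfold stretchF stretchG ridgeC
  simp only [abs_eq_max_neg]
  split_ifs <;> omega

lemma stretchF_sep (m a b : ℤ) (h : a ≠ b) : 1 ≤ |stretchF m a - stretchF m b| := by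
  unfold stretchF
  simp only [abs_eq_max_neg]
  split_ifs <;> omega

lemma stretchG_sep (m a b : ℤ) (h : a ≠ b) : 1 ≤ |stretchG m a - stretchG m b| := by
  unfold stretchG
  simp only [abs_eq_max_neg]
  split_ifs <;> omega

lemma mem_closure_of_sep {n : ℕ} (π : Equiv.Perm (Fin n)) (f : ℤ → ℤ)
    (hf : ∀ a b, a ≠ b → 1 ≤ |f a - f b|) :
    mmap (fun j => ((f ((π j : ℕ) : ℤ) : ℤ) : ℝ)) ∈ closure (Qn n) := by
  refine subset_closure (subset_convexHull ℝ _ ⟨_, ?_, rfl⟩)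
  intro k l hkl
  have h : (((π k : ℕ) : ℤ)) ≠ ((π l : ℕ) : ℤ) := by
    intro h
    exact hkl (π.injective (Fin.ext (by exact_mod_cast h)))
  exact_mod_cast hf _ _ h

theorem stmt13 (n : ℕ) (hn : 3 ≤ n) (π : Equiv.Perm (Fin n)) (U : Finset (Fin n))
    (hU : overRidge π U) :
    ¬ IsExtreme ℝ (closure (Qn n)) (halfline π U) := by
  intro hE
  obtain ⟨k, hk1, hkn, hU⟩ := hU
  obtain ⟨m, rfl⟩ : ∃ m, k = m + 1 := ⟨k - 1, by omega⟩
  have hchi : ∀ j, chi U j = ((ridgeC (m : ℤ) ((π j : ℕ) : ℤ) : ℤ) : ℝ) := by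
    intro j
    have h1 := hU j
    unfold chi ridgeC
    by_cases hj : j ∈ U
    · have h2 := h1.1 hj
      rw [if_pos hj, if_pos (by omega)]; norm_num
    · have h2 := mt h1.2 hj
      rw [if_neg hj, if_neg (by omega)]; norm_num
  have key := hE.left_mem_of_mem_openSegment
    (mem_closure_of_sep π (stretchF m) (stretchF_sep m))
    (mem_closure_of_sep π (stretchG m) (stretchG_sep m))
    (z := Mperm π + (1 : ℝ) • mmap (chi U)) ⟨1, zero_le_one, rfl⟩
    (by
      refine ⟨1/2, 1/2, by norm_num, by norm_num, by norm_num, ?_⟩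
      ext i j
      have h := stretch_id m ((π i : ℕ) : ℤ) ((π j : ℕ) : ℤ)
      have h' : |((stretchF m ((π i : ℕ) : ℤ) : ℤ) : ℝ) - (stretchF m ((π j : ℕ) : ℤ) : ℤ)|
          + |((stretchG m ((π i : ℕ) : ℤ) : ℤ) : ℝ) - (stretchG m ((π j : ℕ) : ℤ) : ℤ)|
          = 2 * |((π i : ℕ) : ℝ) - ((π j : ℕ) : ℝ)|
            + 2 * |((ridgeC m ((π i : ℕ) : ℤ) : ℤ) : ℝ) - (ridgeC m ((π j : ℕ) : ℤ) : ℤ)| := by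
        exact_mod_cast h
      simp only [Matrix.add_apply, Matrix.smul_apply, mmap, Mperm, permVec, hchi, smul_eq_mul,
        add_sub_add_right_eq_sub]
      linarith)
  obtain ⟨t, ht, hEq⟩ := key
  have ent : ∀ a b : Fin n, |((stretchF m ((a : ℕ) : ℤ) : ℤ) : ℝ) - (stretchF m ((b : ℕ) : ℤ) : ℤ)|
      = |((a : ℕ) : ℝ) - ((b : ℕ) : ℝ)|
        + t * |((ridgeC m ((a : ℕ) : ℤ) : ℤ) : ℝ) - (ridgeC m ((b : ℕ) : ℤ) : ℤ)| := by
    intro a b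
    have h := congrFun (congrFun hEq (π.symm a)) (π.symm b)
    simpa only [Matrix.add_apply, Matrix.smul_apply, mmap, Mperm, permVec, hchi, smul_eq_mul,
        add_sub_add_right_eq_sub, Equiv.apply_symm_apply] using h
  -- entry at the swapped pair
  have e1 := ent ⟨m, by omega⟩ ⟨m + 1, by omega⟩
  have ht1 : t = 1 := by
    simp [stretchF, ridgeC] at e1
    norm_num [abs_of_nonneg, abs_of_neg] at e1
    ring_nf at e1
    norm_num at e1
    linarith
  subst ht1
  rcases Nat.eq_zero_or_pos m with rfl | hm
  · have e2 := ent ⟨1, by omega⟩ ⟨2, by omega⟩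
    norm_num [stretchF, ridgeC] at e2
  · have e2 := ent ⟨m - 1, by omega⟩ ⟨m, by omega⟩
    obtain ⟨r, rfl⟩ : ∃ r, m = r + 1 := ⟨m - 1, by omega⟩
    simp [stretchF, ridgeC] at e2
end

section
/- Let n ≥ 3, k ∈ {1,…,n−1}, let id be the identity permutation of [n], let π′ be the transposition of [n] exchanging k and k+1, and let U = {1,…,k−1} ∪ {k+1}. Then, as n×n matrices, M(χ^U) = M(χ^{{1,…,k}}) + (M(π′) − M(id)). -/
open scoped BigOperators Pointwise

theorem stmt14 (n : ℕ) (hn : 3 ≤ n) (k : ℕ) (hk1 : 1 ≤ k) (hk2 : k ≤ n - 1) :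
    mmap (chi (Finset.univ.filter
        (fun j : Fin n => (j : ℕ) + 1 ≤ k - 1 ∨ (j : ℕ) + 1 = k + 1))) =
      mmap (chi (Finset.univ.filter (fun j : Fin n => (j : ℕ) + 1 ≤ k))) +
        (Mperm (Equiv.swap (⟨k - 1, by omega⟩ : Fin n) (⟨k, by omega⟩ : Fin n)) - Mperm 1) := by
  ext i j
  have hs : ∀ i : Fin n, ((Equiv.swap (⟨k - 1, by omega⟩ : Fin n) (⟨k, by omega⟩ : Fin n) i : Fin n) : ℕ)
      = if (i : ℕ) = k - 1 then k else if (i : ℕ) = k then k - 1 else (i : ℕ) := by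
    intro i
    rw [Equiv.swap_apply_def]
    simp only [Fin.ext_iff]
    split_ifs <;> rfl
  simp only [Matrix.add_apply, Matrix.sub_apply, Mperm, mmap, chi, permVec, Finset.mem_filter,
    Finset.mem_univ, true_and, hs, Equiv.Perm.one_apply]
  have key : ∀ a b : ℕ,
      |(if a + 1 ≤ k - 1 ∨ a + 1 = k + 1 then (1 : ℤ) else 0)
        - (if b + 1 ≤ k - 1 ∨ b + 1 = k + 1 then (1 : ℤ) else 0)|
      = |(if a + 1 ≤ k then (1 : ℤ) else 0) - (if b + 1 ≤ k then (1 : ℤ) else 0)|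
        + (|(((if a = k - 1 then k else if a = k then k - 1 else a : ℕ) : ℤ) + 1)
            - (((if b = k - 1 then k else if b = k then k - 1 else b : ℕ) : ℤ) + 1)|
          - |((a : ℤ) + 1) - ((b : ℤ) + 1)|) := by
    intro a b
    simp only [abs_eq_max_neg]
    split_ifs <;> omega
  have h := congrArg (Int.cast : ℤ → ℝ) (key i j)
  simpa only [Int.cast_add, Int.cast_sub, Int.cast_abs, Int.cast_ite, Int.cast_one, Int.cast_zero,
    Int.cast_natCast] using h
end

section
/- Let n ≥ 3 and k ≥ 1 be integers, let U₀ be a nonempty proper subset of [n], and let j ∈ U₀. Define the subset U_k of [n+k] by U_k := {i ∈ U₀ : i ≤ j} ∪ {j+1, …, j+k} ∪ {i + k : i ∈ U₀, i > j} (i.e., the 0/1-word of U_k is obtained from that of U₀ by replacing the 1 in position j by k+1 consecutive 1s). If the half-line M(id_n) + ℝ≥0·M(χ^{U₀}) is an extreme subset of closure(Q_n), then the half-line M(id_{n+k}) + ℝ≥0·M(χ^{U_k}) is an extreme subset of closure(Q_{n+k}). -/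
open scoped BigOperators Pointwise

/-- The cut function of the initial segment `[j]`. -/
noncomputable def cc {n : ℕ} (j i : Fin n) : ℝ := if i ≤ j then 0 else 1

/-- Deleting the index `j+1`. -/
def ee {n : ℕ} (j i : Fin n) : Fin (n + 1) := if i ≤ j then i.castSucc else i.succ

/-- Slack of a triangle inequality. -/
noncomputable def slk {n : ℕ} (j : Fin n) (A : Matrix (Fin (n+1)) (Fin (n+1)) ℝ) (i : Fin n) : ℝ :=
  A j.castSucc j.succ - (2 * cc j i - 1) * (A j.castSucc (ee j i) - A j.succ (ee j i))

noncomputable def ff {n : ℕ} (j : Fin n) (A : Matrix (Fin (n+1)) (Fin (n+1)) ℝ) : ℝ :=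
  (A j.castSucc j.succ - 1) + ∑ i, slk j A i

lemma ee_inj {n : ℕ} (j : Fin n) {a b : Fin n} (h : a ≠ b) : ee j a ≠ ee j b := by
  unfold ee
  split_ifs <;> simp only [ne_eq, Fin.ext_iff, Fin.val_castSucc, Fin.val_succ, Fin.le_def] at * <;> omega

lemma ee_self {n : ℕ} (j : Fin n) : ee j j = j.castSucc := by simp [ee]

lemma ee_ne {n : ℕ} (j i : Fin n) : ee j i ≠ j.succ := by
  unfold ee
  split_ifs <;> simp only [ne_eq, Fin.ext_iff, Fin.val_castSucc, Fin.val_succ, Fin.le_def] at * <;> omega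

lemma ee_cases {n : ℕ} (j : Fin n) (m : Fin (n+1)) : m = j.succ ∨ ∃ i, m = ee j i := by
  rcases lt_trichotomy m j.succ with h | h | h
  · right
    have hm : (m : ℕ) < j + 1 := by simpa [Fin.lt_def] using h
    refine ⟨⟨m, by omega⟩, ?_⟩
    have : (⟨m, by omega⟩ : Fin n) ≤ j := by rw [Fin.le_def]; simp; omega
    simp [ee, this]
  · exact Or.inl h
  · right
    have hm : (j : ℕ) + 1 < m := by simpa [Fin.lt_def] using h
    refine ⟨⟨m - 1, by omega⟩, ?_⟩
    have : ¬ (⟨m - 1, by omega⟩ : Fin n) ≤ j := by rw [Fin.le_def]; simp; omega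
    simp only [ee, this, if_false, Fin.ext_iff, Fin.val_succ]; omega

lemma cc_cases {n : ℕ} (j i : Fin n) : cc j i = 0 ∨ cc j i = 1 := by
  unfold cc; split_ifs <;> simp

lemma slk_nonneg {n : ℕ} (j : Fin n) (x : Fin (n+1) → ℝ) (i : Fin n) : 0 ≤ slk j (mmap x) i := by
  unfold slk mmap
  have h1 := abs_sub_abs_le_abs_sub (x j.castSucc - x (ee j i)) (x j.succ - x (ee j i))
  have h2 := abs_sub_abs_le_abs_sub (x j.succ - x (ee j i)) (x j.castSucc - x (ee j i))
  rw [sub_sub_sub_cancel_right] at h1 h2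
  rw [abs_sub_comm (x j.succ) (x j.castSucc)] at h2
  rcases cc_cases j i with h | h <;> rw [h] <;> linarith

lemma key_pos {n : ℕ} (j : Fin n) (x : Fin (n+1) → ℝ)
    (hx : ∀ k l, k ≠ l → 1 ≤ |x k - x l|) (hpq : x j.castSucc < x j.succ) :
    ∃ y : Fin n → ℝ, (∀ k l, k ≠ l → 1 ≤ |y k - y l|) ∧
      ∀ k l, abs ((|x (ee j k) - x (ee j l)| - |cc j k - cc j l|) - |y k - y l|) ≤ ff j (mmap x) := by
  have hpq1 : 1 ≤ x j.succ - x j.castSucc := by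
    have := hx j.succ j.castSucc (by simp [Fin.ext_iff])
    rwa [abs_of_pos (by linarith)] at this
  have hA : mmap x j.castSucc j.succ = x j.succ - x j.castSucc := by
    unfold mmap; rw [abs_sub_comm, abs_of_pos (by linarith)]
  have hsum : 0 ≤ ∑ i, slk j (mmap x) i := Finset.sum_nonneg fun i _ => slk_nonneg j x i
  have hgap : ∀ a b, a ≠ b → 1 ≤ x a - x b ∨ 1 ≤ x b - x a := by
    intro a b hab
    have := hx a b hab
    rcases le_abs.1 this with h | h
    · exact Or.inl h
    · right; linarith
  have hff : 0 ≤ ff j (mmap x) := by unfold ff; rw [hA]; linarith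
  by_cases hgood : (∀ i, i ≤ j → x (ee j i) ≤ x j.castSucc) ∧ (∀ i, ¬ i ≤ j → x j.succ ≤ x (ee j i))
  · obtain ⟨hg1, hg2⟩ := hgood
    have hg2' : ∀ i, ¬ i ≤ j → x j.succ + 1 ≤ x (ee j i) := by
      intro i hi
      have := hg2 i hi
      rcases hgap _ _ (ee_ne j i) with h | h <;> linarith
    have hform : ∀ k l, |x (ee j k) - x (ee j l)| - |cc j k - cc j l|
        = |(x (ee j k) - cc j k) - (x (ee j l) - cc j l)| := by
      intro k l
      by_cases hk : k ≤ j <;> by_cases hl : l ≤ j <;> simp only [cc, hk, hl, if_true, if_false]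
      · simp
      · have := hg1 k hk; have := hg2' l hl
        rw [abs_of_neg (by linarith), abs_of_neg (by linarith), abs_of_neg (by linarith)]; ring
      · have := hg1 l hl; have := hg2' k hk
        rw [abs_of_pos (by linarith), abs_of_pos (by linarith), abs_of_pos (by linarith)]; ring
      · simp
    refine ⟨fun i => x (ee j i) - cc j i, ?_, ?_⟩
    · intro k l hkl
      have h1 := hx _ _ (ee_inj j hkl)
      show 1 ≤ |(x (ee j k) - cc j k) - (x (ee j l) - cc j l)|
      by_cases hk : k ≤ j <;> by_cases hl : l ≤ j <;> simp only [cc, hk, hl, if_true, if_false]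
      · simpa using h1
      · have := hg1 k hk; have := hg2' l hl
        rw [abs_of_neg (by linarith)]; linarith
      · have := hg1 l hl; have := hg2' k hk
        rw [abs_of_pos (by linarith)]; linarith
      · simpa using h1
    · intro k l
      rw [hform]; simpa using hff
  · have hbad : ∃ i, 1 ≤ slk j (mmap x) i := by
      rw [not_and_or] at hgood
      push Not at hgood
      rcases hgood with ⟨i, hi, h⟩ | ⟨i, hi, h⟩
      · refine ⟨i, ?_⟩
        have hne : ee j i ≠ j.castSucc := by intro he; rw [he] at h; exact lt_irrefl _ h
        have hg : 1 ≤ x (ee j i) - x j.castSucc := by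
          rcases hgap _ _ hne with h | h <;> linarith
        have hc : cc j i = 0 := by simp [cc, hi]
        unfold slk; rw [hA, hc]; unfold mmap
        rw [abs_sub_comm, abs_of_pos (by linarith)]
        rcases abs_cases (x j.succ - x (ee j i)) with h | h <;> linarith
      · refine ⟨i, ?_⟩
        have hg : 1 ≤ x j.succ - x (ee j i) := by
          rcases hgap _ _ (ee_ne j i) with h | h <;> linarith
        have hc : cc j i = 1 := by simp [cc, not_le.2 hi]
        unfold slk; rw [hA, hc]; unfold mmap
        rw [abs_of_pos (show 0 < x j.succ - x (ee j i) by linarith)]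
        rcases abs_cases (x j.castSucc - x (ee j i)) with h | h <;> linarith
    obtain ⟨i, hi⟩ := hbad
    have h1 : slk j (mmap x) i ≤ ∑ i, slk j (mmap x) i :=
      Finset.single_le_sum (fun i _ => slk_nonneg j x i) (Finset.mem_univ i)
    have h2 : 1 ≤ ff j (mmap x) := by unfold ff; rw [hA]; linarith
    refine ⟨fun i => x (ee j i), fun k l hkl => hx _ _ (ee_inj j hkl), fun k l => ?_⟩
    have h3 : abs ((|x (ee j k) - x (ee j l)| - |cc j k - cc j l|) - |x (ee j k) - x (ee j l)|)
        = |cc j k - cc j l| := by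
      rw [sub_sub_cancel_left, abs_neg, abs_abs]
    refine le_trans (le_of_eq h3) (le_trans ?_ h2)
    rcases cc_cases j k with h | h <;> rcases cc_cases j l with h' | h' <;> rw [h, h'] <;> norm_num

lemma mmap_neg {n : ℕ} (x : Fin n → ℝ) : mmap (fun i => - x i) = mmap x := by
  funext k l
  unfold mmap
  rw [neg_sub_neg, abs_sub_comm]

lemma key {n : ℕ} (j : Fin n) (x : Fin (n+1) → ℝ)
    (hx : ∀ k l, k ≠ l → 1 ≤ |x k - x l|) :
    ∃ y : Fin n → ℝ, (∀ k l, k ≠ l → 1 ≤ |y k - y l|) ∧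
      ∀ k l, |(mmap x (ee j k) (ee j l) - |cc j k - cc j l|) - mmap y k l| ≤ ff j (mmap x) := by
  rcases lt_trichotomy (x j.castSucc) (x j.succ) with h | h | h
  · exact key_pos j x hx h
  · have := hx j.castSucc j.succ (by simp [Fin.ext_iff])
    rw [h] at this; norm_num at this
  · have := key_pos j (fun i => - x i) (fun k l hkl => by
      rw [neg_sub_neg, abs_sub_comm]; exact hx k l hkl) (by simpa using h)
    obtain ⟨y, hy, hy2⟩ := this
    refine ⟨y, hy, fun k l => ?_⟩
    have := hy2 k l
    rw [mmap_neg] at this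
    refine le_trans (le_of_eq ?_) this
    unfold mmap
    rw [neg_sub_neg, abs_sub_comm (x (ee j k))]

lemma slk_comb {n : ℕ} (j : Fin n) (A B : Matrix (Fin (n+1)) (Fin (n+1)) ℝ) (a b : ℝ) (i : Fin n) :
    slk j (a • A + b • B) i = a * slk j A i + b * slk j B i := by
  simp only [slk, Matrix.add_apply, Matrix.smul_apply, smul_eq_mul]; ring

lemma ff_comb {n : ℕ} (j : Fin n) (A B : Matrix (Fin (n+1)) (Fin (n+1)) ℝ) (a b : ℝ)
    (hab : a + b = 1) : ff j (a • A + b • B) = a * ff j A + b * ff j B := by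
  simp only [ff, slk_comb, Finset.sum_add_distrib, ← Finset.mul_sum]
  simp only [Matrix.add_apply, Matrix.smul_apply, smul_eq_mul]
  linear_combination hab

lemma key_conv {n : ℕ} (j : Fin n) (A : Matrix (Fin (n+1)) (Fin (n+1)) ℝ) (hA : A ∈ Qn (n+1)) :
    ∃ Y ∈ Qn n, ∀ k l, |(A (ee j k) (ee j l) - |cc j k - cc j l|) - Y k l| ≤ ff j A := by
  have : Qn (n+1) ⊆ {A | ∃ Y ∈ Qn n, ∀ k l,
      |(A (ee j k) (ee j l) - |cc j k - cc j l|) - Y k l| ≤ ff j A} := by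
    apply convexHull_min
    · rintro X ⟨x, hx, rfl⟩
      obtain ⟨y, hy, hy2⟩ := key j x hx
      exact ⟨mmap y, subset_convexHull ℝ _ ⟨y, hy, rfl⟩, hy2⟩
    · rintro A ⟨Y, hY, hA⟩ B ⟨Z, hZ, hB⟩ a b ha hb hab
      refine ⟨a • Y + b • Z, convex_convexHull ℝ _ hY hZ ha hb hab, fun k l => ?_⟩
      rw [ff_comb j A B a b hab]
      have h1 := mul_le_mul_of_nonneg_left (hA k l) ha
      have h2 := mul_le_mul_of_nonneg_left (hB k l) hb
      rw [← abs_of_nonneg ha, ← abs_mul, abs_of_nonneg ha] at h1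
      rw [← abs_of_nonneg hb, ← abs_mul, abs_of_nonneg hb] at h2
      refine le_trans (le_of_eq ?_) ((abs_add_le _ _).trans (add_le_add h1 h2))
      congr 1
      simp only [Matrix.add_apply, Matrix.smul_apply, smul_eq_mul]
      linear_combination (|cc j k - cc j l|) * hab
  exact this hA

lemma ent_cont {n : ℕ} (k l : Fin n) : Continuous (fun A : Matrix (Fin n) (Fin n) ℝ => A k l) :=
  continuous_id.matrix_elem k l

lemma slk_cont {n : ℕ} (j i : Fin n) : Continuous (fun A => slk j A i) := by
  unfold slk
  exact (ent_cont _ _).sub (continuous_const.mul ((ent_cont _ _).sub (ent_cont _ _)))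

lemma ff_cont {n : ℕ} (j : Fin n) : Continuous (fun A => ff j A) := by
  unfold ff
  exact ((ent_cont _ _).sub continuous_const).add (continuous_finsetSum _ fun i _ => slk_cont j i)

lemma key_closure {n : ℕ} (j : Fin n) (A : Matrix (Fin (n+1)) (Fin (n+1)) ℝ)
    (hA : A ∈ closure (Qn (n+1))) (hf : ff j A = 0) :
    (fun k l => A (ee j k) (ee j l) - |cc j k - cc j l| : Matrix (Fin n) (Fin n) ℝ)
      ∈ closure (Qn n) := by
  have : FrechetUrysohnSpace (Matrix (Fin (n+1)) (Fin (n+1)) ℝ) :=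
    inferInstanceAs (FrechetUrysohnSpace (Fin (n+1) → Fin (n+1) → ℝ))
  obtain ⟨u, hu, hlim⟩ := mem_closure_iff_seq_limit.1 hA
  choose Y hY hYb using fun m => key_conv j (u m) (hu m)
  refine mem_closure_of_tendsto (f := Y) (b := Filter.atTop) ?_ (Filter.Eventually.of_forall hY)
  refine tendsto_pi_nhds.2 fun k => tendsto_pi_nhds.2 fun l => ?_
  have h1 : Filter.Tendsto (fun m => ff j (u m)) Filter.atTop (nhds 0) := by
    have := ((ff_cont j).tendsto A).comp hlim
    rwa [hf] at this
  have h2 : Filter.Tendsto (fun m => u m (ee j k) (ee j l) - |cc j k - cc j l|) Filter.atTop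
      (nhds (A (ee j k) (ee j l) - |cc j k - cc j l|)) :=
    (((ent_cont (ee j k) (ee j l)).tendsto A).comp hlim).sub_const _
  have h3 := squeeze_zero_norm (fun m => by
    rw [Real.norm_eq_abs]; exact hYb m k l) h1
  have h4 := h2.sub h3
  simpa using h4

lemma closure_props {n : ℕ} (j : Fin n) (A : Matrix (Fin (n+1)) (Fin (n+1)) ℝ)
    (hA : A ∈ closure (Qn (n+1))) :
    1 ≤ A j.castSucc j.succ ∧ (∀ i, 0 ≤ slk j A i) ∧ (∀ k l, A k l = A l k) ∧ (∀ k, A k k = 0) := by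
  have : closure (Qn (n+1)) ⊆ {A | 1 ≤ A j.castSucc j.succ ∧ (∀ i, 0 ≤ slk j A i) ∧
      (∀ k l, A k l = A l k) ∧ (∀ k, A k k = 0)} := by
    apply closure_minimal
    · apply convexHull_min
      · rintro X ⟨x, hx, rfl⟩
        refine ⟨hx _ _ (by simp [Fin.ext_iff]), slk_nonneg j x, fun k l => abs_sub_comm _ _,
          fun k => by simp [mmap]⟩
      · rintro A ⟨a1, a2, a3, a4⟩ B ⟨b1, b2, b3, b4⟩ a b ha hb hab
        refine ⟨?_, fun i => ?_, fun k l => ?_, fun k => ?_⟩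
        · simp only [Matrix.add_apply, Matrix.smul_apply, smul_eq_mul]; nlinarith
        · rw [slk_comb]
          exact add_nonneg (mul_nonneg ha (a2 i)) (mul_nonneg hb (b2 i))
        · simp only [Matrix.add_apply, Matrix.smul_apply, smul_eq_mul]; rw [a3 k l, b3 k l]
        · simp only [Matrix.add_apply, Matrix.smul_apply, smul_eq_mul]; rw [a4 k, b4 k]; simp
    · have c1 : IsClosed {A : Matrix (Fin (n+1)) (Fin (n+1)) ℝ | 1 ≤ A j.castSucc j.succ} :=
        isClosed_le continuous_const (ent_cont _ _)
      have c2 : IsClosed {A : Matrix (Fin (n+1)) (Fin (n+1)) ℝ | ∀ i, 0 ≤ slk j A i} := by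
        simp only [Set.ofPred_forall]
        exact isClosed_iInter fun i => isClosed_le continuous_const (slk_cont j i)
      have c3 : IsClosed {A : Matrix (Fin (n+1)) (Fin (n+1)) ℝ | ∀ k l, A k l = A l k} := by
        simp only [Set.ofPred_forall]
        exact isClosed_iInter fun k => isClosed_iInter fun l =>
          isClosed_eq (ent_cont _ _) (ent_cont _ _)
      have c4 : IsClosed {A : Matrix (Fin (n+1)) (Fin (n+1)) ℝ | ∀ k, A k k = 0} := by
        simp only [Set.ofPred_forall]
        exact isClosed_iInter fun k => isClosed_eq (ent_cont _ _) continuous_const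
      exact c1.inter (c2.inter (c3.inter c4))
  exact this hA

lemma halfline_sub {n : ℕ} (U : Finset (Fin n)) : halfline 1 U ⊆ closure (Qn n) := by
  rintro X ⟨t, ht, rfl⟩
  have hval : ∀ k l : Fin n, permVec (1 : Equiv.Perm (Fin n)) k - permVec 1 l = (k : ℝ) - l := by
    intro k l; simp [permVec]
  have hbd : ∀ k l : Fin n, |(k : ℝ) - l| ≤ n := by
    intro k l
    have h1 : (k : ℝ) ≤ n := by exact_mod_cast k.2.le
    have h2 : (l : ℝ) ≤ n := by exact_mod_cast l.2.le
    have h3 : (0 : ℝ) ≤ k := by positivity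
    have h4 : (0 : ℝ) ≤ l := by positivity
    rw [abs_le]; constructor <;> linarith
  have hgap : ∀ k l : Fin n, k ≠ l → 1 ≤ |(k : ℝ) - l| := by
    intro k l hkl
    have : (1 : ℤ) ≤ |(k : ℤ) - l| := by
      apply Int.one_le_abs
      have : (k : ℕ) ≠ l := fun h => hkl (Fin.ext h)
      omega
    exact_mod_cast this
  let T : ℕ → ℝ := fun m => t * (m + 1) + n + 1
  have hT : ∀ m, (n : ℝ) + 1 ≤ T m := by
    intro m
    have : 0 ≤ t * ((m : ℝ) + 1) := by positivity
    simp only [T]; linarith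
  let x : ℕ → Fin n → ℝ := fun m i => permVec 1 i + T m * chi U i
  have hchi : ∀ i, chi U i = 0 ∨ chi U i = 1 := by
    intro i; unfold chi; split_ifs <;> simp
  have hxd : ∀ m k l, x m k - x m l = (k : ℝ) - l + T m * (chi U k - chi U l) := by
    intro m k l
    rw [← hval k l]; simp only [x]; ring
  let u : ℕ → Matrix (Fin n) (Fin n) ℝ := fun m =>
    (1 - 1 / ((m : ℝ) + 1)) • Mperm 1 + (1 / ((m : ℝ) + 1)) • mmap (x m)
  have hid : ∀ m, mmap (x m) ∈ Qn n := by
    intro m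
    refine subset_convexHull ℝ _ ⟨x m, fun k l hkl => ?_, rfl⟩
    rw [hxd]
    have h1 := hgap k l hkl
    have h2 := abs_le.1 (hbd k l)
    have h3 := hT m
    rcases hchi k with h | h <;> rcases hchi l with h' | h' <;> rw [h, h']
    · simpa using h1
    · rw [abs_of_neg (by linarith)]; linarith
    · rw [abs_of_pos (by linarith)]; linarith
    · simpa using h1
  have hM : Mperm (1 : Equiv.Perm (Fin n)) ∈ Qn n := by
    refine subset_convexHull ℝ _ ⟨_, fun k l hkl => ?_, rfl⟩
    rw [hval]; exact hgap k l hkl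
  refine mem_closure_of_tendsto (f := u) (b := Filter.atTop) ?_ (Filter.Eventually.of_forall ?_)
  · refine tendsto_pi_nhds.2 fun k => tendsto_pi_nhds.2 fun l => ?_
    let R : ℝ := (n + 1 - |(k : ℝ) - l|) * |chi U k - chi U l| + ((k : ℝ) - l) * (chi U k - chi U l)
    have hu : ∀ m, u m k l = (Mperm 1 + t • mmap (chi U) : Matrix (Fin n) (Fin n) ℝ) k l + (1 / ((m : ℝ) + 1)) * R := by
      intro m
      have hm : (m : ℝ) + 1 ≠ 0 := by positivity
      have h2 := abs_le.1 (hbd k l)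
      have h3 := hT m
      simp only [u, R, Matrix.add_apply, Matrix.smul_apply, smul_eq_mul, Mperm, mmap, hval, hxd]
      rcases hchi k with h | h <;> rcases hchi l with h' | h' <;> rw [h, h']
      · simp; ring
      · rw [abs_of_neg (show (k : ℝ) - l + T m * (0 - 1) < 0 by linarith)]
        norm_num
        simp only [T]; field_simp; ring
      · rw [abs_of_pos (show 0 < (k : ℝ) - l + T m * (1 - 0) by linarith)]
        norm_num
        simp only [T]; field_simp; ring
      · simp; ring
    have h0 := (tendsto_one_div_add_atTop_nhds_zero_nat (𝕜 := ℝ)).mul_const R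
    have h1 := h0.const_add ((Mperm 1 + t • mmap (chi U) : Matrix (Fin n) (Fin n) ℝ) k l)
    simp only [zero_mul, add_zero] at h1
    exact h1.congr fun m => (hu m).symm
  · intro m
    have hm : (0 : ℝ) < (m : ℝ) + 1 := by positivity
    refine convex_convexHull ℝ _ hM (hid m) ?_ (by positivity) (by ring)
    rw [sub_nonneg, div_le_one hm]
    have : (0 : ℝ) ≤ m := by positivity
    linarith

lemma step {n : ℕ} (U : Finset (Fin n)) (j : Fin n) (U' : Finset (Fin (n + 1)))
    (hU : ∀ i, ee j i ∈ U' ↔ i ∈ U) (hq : j.succ ∈ U' ↔ j ∈ U)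
    (h : IsExtreme ℝ (closure (Qn n)) (halfline 1 U)) :
    IsExtreme ℝ (closure (Qn (n + 1))) (halfline 1 U') := by
  have hchi : ∀ i, chi U' (ee j i) = chi U i := by intro i; simp [chi, hU]
  have hchq : chi U' j.succ = chi U j := by simp [chi, hq]
  have hchp : chi U' j.castSucc = chi U j := by rw [← ee_self, hchi]
  have hpv : ∀ m (k : Fin m), permVec (1 : Equiv.Perm (Fin m)) k = (k : ℝ) + 1 := by
    intro m k; simp [permVec]
  have heev : ∀ i, ((ee j i : Fin (n+1)) : ℝ) = (i : ℝ) + cc j i := by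
    intro i; unfold ee cc; split_ifs
    · rw [Fin.val_castSucc, add_zero]
    · rw [Fin.val_succ, Nat.cast_add, Nat.cast_one]
  have hle : ∀ i, i ≤ j → (i : ℝ) ≤ j := by intro i hi; exact_mod_cast hi
  have hlt : ∀ i, ¬ i ≤ j → (j : ℝ) + 1 ≤ i := by
    intro i hi
    have : (j : ℕ) + 1 ≤ i := by
      rw [Fin.le_def] at hi
      omega
    exact_mod_cast this
  -- points of the half-line
  have hpt : ∀ t : ℝ, ∀ a b, (Mperm 1 + t • mmap (chi U') : Matrix (Fin (n+1)) (Fin (n+1)) ℝ) a b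
      = |(a : ℝ) - b| + t * |chi U' a - chi U' b| := by
    intro t a b
    simp [Mperm, mmap, hpv]
  have hpt0 : ∀ t : ℝ, ∀ a b, (Mperm 1 + t • mmap (chi U) : Matrix (Fin n) (Fin n) ℝ) a b
      = |(a : ℝ) - b| + t * |chi U a - chi U b| := by
    intro t a b
    simp [Mperm, mmap, hpv]
  have hdel : ∀ (t : ℝ) (k l : Fin n), (Mperm 1 + t • mmap (chi U') : Matrix (Fin (n+1)) (Fin (n+1)) ℝ) (ee j k) (ee j l) - |cc j k - cc j l|
      = (Mperm 1 + t • mmap (chi U) : Matrix (Fin n) (Fin n) ℝ) k l := by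
    intro t k l
    rw [hpt, hpt0, hchi, hchi, heev, heev]
    by_cases hk : k ≤ j <;> by_cases hl : l ≤ j <;> simp only [cc, hk, hl, if_true, if_false]
    · simp
    · have := hle k hk; have := hlt l hl
      rw [abs_of_neg (by linarith), abs_of_neg (show (0:ℝ)-1<0 by linarith), abs_of_neg (show (k:ℝ)-l<0 by linarith)]; ring
    · have := hle l hl; have := hlt k hk
      rw [abs_of_pos (by linarith), abs_of_pos (show (0:ℝ)<1-0 by linarith), abs_of_pos (show 0<(k:ℝ)-l by linarith)]; ring
    · simp
  have hpq : ∀ t : ℝ, (Mperm 1 + t • mmap (chi U') : Matrix (Fin (n+1)) (Fin (n+1)) ℝ) j.castSucc j.succ = 1 := by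
    intro t; rw [hpt, hchq, hchp]; simp
  have hslk : ∀ (t : ℝ) (i : Fin n), slk j (Mperm 1 + t • mmap (chi U') : Matrix (Fin (n+1)) (Fin (n+1)) ℝ) i = 0 := by
    intro t i
    unfold slk
    rw [hpq, hpt, hpt, hchq, hchp, hchi, heev]
    by_cases hi : i ≤ j <;> simp only [cc, hi, if_true, if_false, Fin.val_castSucc, Fin.val_succ] <;> push_cast
    · have := hle i hi
      rw [abs_of_nonneg (by linarith), abs_of_nonneg (show (0:ℝ) ≤ (j:ℝ)+1-(i+0) by linarith)]; ring
    · have := hlt i hi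
      rw [abs_of_nonpos (by linarith), abs_of_nonpos (show (j:ℝ)+1-(i+1) ≤ 0 by linarith)]; ring
  refine ⟨halfline_sub U', ?_⟩
  rintro A hA B hB X ⟨t, ht, rfl⟩ ⟨a, b, ha, hb, hab, hX⟩
  obtain ⟨a1, a2, a3, a4⟩ := closure_props j A hA
  obtain ⟨b1, b2, b3, b4⟩ := closure_props j B hB
  have hX1 := hpq t
  rw [← hX] at hX1
  simp only [Matrix.add_apply, Matrix.smul_apply, smul_eq_mul] at hX1
  have hA1 : A j.castSucc j.succ = 1 := by
    by_contra hne
    have : 1 < A j.castSucc j.succ := lt_of_le_of_ne a1 (Ne.symm hne)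
    nlinarith
  have hB1 : B j.castSucc j.succ = 1 := by
    by_contra hne
    have : 1 < B j.castSucc j.succ := lt_of_le_of_ne b1 (Ne.symm hne)
    nlinarith
  have hAB : ∀ i, slk j A i = 0 ∧ slk j B i = 0 := by
    intro i
    have := hslk t i
    rw [← hX, slk_comb] at this
    have h1 := mul_nonneg ha.le (a2 i)
    have h2 := mul_nonneg hb.le (b2 i)
    constructor
    · have : a * slk j A i = 0 := by linarith
      simpa [ha.ne'] using this
    · have : b * slk j B i = 0 := by linarith
      simpa [hb.ne'] using this
  have hfA : ff j A = 0 := by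
    unfold ff; rw [hA1, Finset.sum_eq_zero fun i _ => (hAB i).1]; ring
  have hfB : ff j B = 0 := by
    unfold ff; rw [hB1, Finset.sum_eq_zero fun i _ => (hAB i).2]; ring
  have hA0 := key_closure j A hA hfA
  have hB0 := key_closure j B hB hfB
  have hmem := h.2 hA0 hB0 (z := Mperm 1 + t • mmap (chi U)) ⟨t, ht, rfl⟩ ⟨a, b, ha, hb, hab, by
    ext k l
    rw [← hdel, ← hX]
    show a * (A (ee j k) (ee j l) - |cc j k - cc j l|) + b * (B (ee j k) (ee j l) - |cc j k - cc j l|)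
      = a * A (ee j k) (ee j l) + b * B (ee j k) (ee j l) - |cc j k - cc j l|
    linear_combination (- |cc j k - cc j l|) * hab⟩
  obtain ⟨s, hs, hs2⟩ := hmem
  refine ⟨s, hs, ?_⟩
  have hee : ∀ k l, A (ee j k) (ee j l) = (Mperm 1 + s • mmap (chi U') : Matrix (Fin (n+1)) (Fin (n+1)) ℝ) (ee j k) (ee j l) := by
    intro k l
    have h1 := congrFun (congrFun hs2 k) l
    have h2 := hdel s k l
    linarith
  have hsymm : ∀ k l, (Mperm 1 + s • mmap (chi U') : Matrix (Fin (n+1)) (Fin (n+1)) ℝ) k l = (Mperm 1 + s • mmap (chi U') : Matrix (Fin (n+1)) (Fin (n+1)) ℝ) l k := by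
    intro k l; rw [hpt, hpt, abs_sub_comm, abs_sub_comm (chi U' k)]
  have hqe : ∀ i, A j.succ (ee j i) = (Mperm 1 + s • mmap (chi U') : Matrix (Fin (n+1)) (Fin (n+1)) ℝ) j.succ (ee j i) := by
    intro i
    have h1 := (hAB i).1
    have h2 := hslk s i
    have h3 := hee j i
    rw [ee_self] at h3
    unfold slk at h1 h2
    rw [hpq] at h2
    rw [hA1] at h1
    rcases cc_cases j i with hc | hc <;> rw [hc] at h1 h2 <;> linarith
  ext k l
  rcases ee_cases j k with rfl | ⟨k, rfl⟩ <;> rcases ee_cases j l with rfl | ⟨l, rfl⟩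
  · rw [a4, hpt]; simp
  · exact hqe l
  · rw [a3, hsymm]; exact hqe k
  · exact hee k l

open Classical in
lemma main_ind (n k : ℕ) (U₀ : Finset (Fin n)) (j : Fin n) (hj : j ∈ U₀)
    (h : IsExtreme ℝ (closure (Qn n)) (halfline 1 U₀)) :
    IsExtreme ℝ (closure (Qn (n + k)))
      (halfline 1 (Finset.univ.filter (fun m : Fin (n + k) =>
        (∃ i ∈ U₀, (i : ℕ) ≤ (j : ℕ) ∧ (m : ℕ) = (i : ℕ)) ∨
        ((j : ℕ) < (m : ℕ) ∧ (m : ℕ) ≤ (j : ℕ) + k) ∨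
        (∃ i ∈ U₀, (j : ℕ) < (i : ℕ) ∧ (m : ℕ) = (i : ℕ) + k)))) := by
  induction k with
  | zero =>
    refine Eq.mp ?_ h
    congr 2
    symm
    refine Finset.ext fun (m : Fin n) => ?_
    refine (Finset.mem_filter_univ (α := Fin n) _).trans ?_
    simp only [Nat.add_zero]
    constructor
    · rintro (⟨i, hi, _, h2⟩ | h | ⟨i, hi, _, h2⟩)
      · rwa [show m = i from Fin.ext h2]
      · omega
      · rwa [show m = i from Fin.ext h2]
    · intro hm
      rcases le_or_gt (m : ℕ) j with h | h
      · exact Or.inl ⟨m, hm, h, rfl⟩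
      · exact Or.inr (Or.inr ⟨m, hm, h, rfl⟩)
  | succ k ih =>
    have hjk : (j : ℕ) < n + k := by omega
    refine step _ (⟨j, hjk⟩ : Fin (n + k)) _ ?_ ?_ ih
    · intro m
      have hev : ((ee (⟨j, hjk⟩ : Fin (n + k)) m : Fin (n+k+1)) : ℕ)
          = if (m : ℕ) ≤ j then (m : ℕ) else m + 1 := by
        unfold ee; simp only [Fin.le_def]; split_ifs <;> simp
      refine (Finset.mem_filter_univ _).trans (Iff.trans ?_ (Finset.mem_filter_univ _).symm)
      rw [hev]
      split_ifs with hm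
      · refine or_congr Iff.rfl (or_congr (by omega) ?_)
        exact exists_congr fun i => and_congr_right fun _ => by omega
      · refine or_congr ?_ (or_congr (by omega) ?_) <;>
        exact exists_congr fun i => and_congr_right fun _ => by omega
    · refine (Finset.mem_filter_univ _).trans (Iff.trans ?_ (Finset.mem_filter_univ _).symm)
      refine iff_of_true (Or.inr (Or.inl ⟨?_, ?_⟩)) (Or.inl ⟨j, hj, le_rfl, rfl⟩)
      · simp
      · simp

open Classical in
theorem stmt16 (n k : ℕ) (hn : 3 ≤ n) (hk : 1 ≤ k) (U₀ : Finset (Fin n))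
    (hne : U₀.Nonempty) (hpr : U₀ ≠ Finset.univ) (j : Fin n) (hj : j ∈ U₀)
    (h : IsExtreme ℝ (closure (Qn n)) (halfline 1 U₀)) :
    IsExtreme ℝ (closure (Qn (n + k)))
      (halfline 1 (Finset.univ.filter (fun m : Fin (n + k) =>
        (∃ i ∈ U₀, (i : ℕ) ≤ (j : ℕ) ∧ (m : ℕ) = (i : ℕ)) ∨
        ((j : ℕ) < (m : ℕ) ∧ (m : ℕ) ≤ (j : ℕ) + k) ∨
        (∃ i ∈ U₀, (j : ℕ) < (i : ℕ) ∧ (m : ℕ) = (i : ℕ) + k)))) :=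
  main_ind n k U₀ j hj h
end

section
/- Let n ≥ 5 and let U be an alternating subset of [n], i.e., U is either the set of all odd numbers in [n] or the set of all even numbers in [n]. Then the half-line M(id) + ℝ≥0·M(χ^U) is an extreme subset of closure(Q_n), i.e., an unbounded edge of the polyhedron closure(Q_n), where id is the identity permutation of [n]. -/
open scoped BigOperators Pointwise

theorem quad_aux (p q r s : ℝ) (h1 : 1 ≤ |p - q|) (h2 : 1 ≤ |q - r|) (h3 : 1 ≤ |r - s|)
    (h4 : 1 ≤ |s - p|) (h5 : 1 ≤ |p - r|) (h6 : 1 ≤ |q - s|) :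
    2 ≤ |p - q| + |q - r| + |r - s| + |s - p| - |p - r| - |q - s| := by
  rcases abs_cases (p - q) with ⟨e1, _⟩ | ⟨e1, _⟩ <;> rw [e1] at h1 ⊢ <;>
  rcases abs_cases (q - r) with ⟨e2, _⟩ | ⟨e2, _⟩ <;> rw [e2] at h2 ⊢ <;>
  rcases abs_cases (r - s) with ⟨e3, _⟩ | ⟨e3, _⟩ <;> rw [e3] at h3 ⊢ <;>
  rcases abs_cases (s - p) with ⟨e4, _⟩ | ⟨e4, _⟩ <;> rw [e4] at h4 ⊢ <;>
  rcases abs_cases (p - r) with ⟨e5, _⟩ | ⟨e5, _⟩ <;> rw [e5] at h5 ⊢ <;>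
  rcases abs_cases (q - s) with ⟨e6, _⟩ | ⟨e6, _⟩ <;> rw [e6] at h6 ⊢ <;> linarith

theorem star_aux (p q r c : ℝ) (h1 : 1 ≤ |p - c|) (h2 : 1 ≤ |q - c|) (h3 : 1 ≤ |r - c|) :
    2 ≤ 2 * |p - c| + 2 * |q - c| + 2 * |r - c| - |p - q| - |p - r| - |q - r| := by
  rcases abs_cases (p - c) with ⟨e1, _⟩ | ⟨e1, _⟩ <;> rw [e1] at h1 ⊢ <;>
  rcases abs_cases (q - c) with ⟨e2, _⟩ | ⟨e2, _⟩ <;> rw [e2] at h2 ⊢ <;>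
  rcases abs_cases (r - c) with ⟨e3, _⟩ | ⟨e3, _⟩ <;> rw [e3] at h3 ⊢ <;>
  rcases abs_cases (p - q) with ⟨e4, _⟩ | ⟨e4, _⟩ <;> rw [e4] <;>
  rcases abs_cases (p - r) with ⟨e5, _⟩ | ⟨e5, _⟩ <;> rw [e5] <;>
  rcases abs_cases (q - r) with ⟨e6, _⟩ | ⟨e6, _⟩ <;> rw [e6] <;> linarith

/-- The relaxation of the closure of `Qn` used in the proof. -/
structure Good {n : ℕ} (X : Matrix (Fin n) (Fin n) ℝ) : Prop where
  symm : ∀ i j, X i j = X j i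
  zero : ∀ i, X i i = 0
  tri : ∀ i j k, 0 ≤ X i j + X j k - X i k
  one : ∀ i j, i ≠ j → 1 ≤ X i j
  quad : ∀ p q r s, p ≠ q → q ≠ r → r ≠ s → s ≠ p → p ≠ r → q ≠ s →
    2 ≤ X p q + X q r + X r s + X s p - X p r - X q s
  star : ∀ p q r c, p ≠ c → q ≠ c → r ≠ c →
    2 ≤ 2 * X p c + 2 * X q c + 2 * X r c - X p q - X p r - X q r

theorem good_mmap {n : ℕ} (x : Fin n → ℝ) (hx : ∀ k l : Fin n, k ≠ l → 1 ≤ |x k - x l|) :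
    Good (mmap x) where
  symm i j := abs_sub_comm _ _
  zero i := by simp [mmap]
  tri i j k := by
    have := abs_sub_le (x i) (x j) (x k)
    simp only [mmap]; linarith
  one i j h := hx i j h
  quad p q r s h1 h2 h3 h4 h5 h6 :=
    quad_aux _ _ _ _ (hx _ _ h1) (hx _ _ h2) (hx _ _ h3) (hx _ _ h4) (hx _ _ h5) (hx _ _ h6)
  star p q r c h1 h2 h3 := star_aux _ _ _ _ (hx _ _ h1) (hx _ _ h2) (hx _ _ h3)

theorem good_convex (n : ℕ) : Convex ℝ {X : Matrix (Fin n) (Fin n) ℝ | Good X} := by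
  intro X hX Y hY a b ha hb hab
  have key : ∀ u v c : ℝ, c ≤ u → c ≤ v → c ≤ a * u + b * v := by
    intro u v c h1 h2
    have e1 := mul_le_mul_of_nonneg_left h1 ha
    have e2 := mul_le_mul_of_nonneg_left h2 hb
    have : c = a * c + b * c := by rw [← add_mul, hab, one_mul]
    linarith
  refine ⟨?_, ?_, ?_, ?_, ?_, ?_⟩
  · intro i j
    simp [hX.symm i j, hY.symm i j]
  · intro i
    simp [hX.zero i, hY.zero i]
  · intro i j k
    have := key _ _ _ (hX.tri i j k) (hY.tri i j k)
    simp only [Matrix.add_apply, Matrix.smul_apply, smul_eq_mul]; linarith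
  · intro i j h
    have := key _ _ _ (hX.one i j h) (hY.one i j h)
    simp only [Matrix.add_apply, Matrix.smul_apply, smul_eq_mul]; linarith
  · intro p q r s h1 h2 h3 h4 h5 h6
    have := key _ _ _ (hX.quad p q r s h1 h2 h3 h4 h5 h6) (hY.quad p q r s h1 h2 h3 h4 h5 h6)
    simp only [Matrix.add_apply, Matrix.smul_apply, smul_eq_mul]; linarith
  · intro p q r c h1 h2 h3
    have := key _ _ _ (hX.star p q r c h1 h2 h3) (hY.star p q r c h1 h2 h3)
    simp only [Matrix.add_apply, Matrix.smul_apply, smul_eq_mul]; linarith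

theorem good_closed (n : ℕ) : IsClosed {X : Matrix (Fin n) (Fin n) ℝ | Good X} := by
  have hc : ∀ i j : Fin n, Continuous (fun X : Matrix (Fin n) (Fin n) ℝ => X i j) :=
    fun i j => continuous_id.matrix_elem i j
  have e : {X : Matrix (Fin n) (Fin n) ℝ | Good X} =
      {X | (∀ i j, X i j = X j i) ∧ (∀ i, X i i = 0) ∧ (∀ i j k, 0 ≤ X i j + X j k - X i k) ∧
        (∀ i j, i ≠ j → 1 ≤ X i j) ∧
        (∀ p q r s, p ≠ q → q ≠ r → r ≠ s → s ≠ p → p ≠ r → q ≠ s →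
          2 ≤ X p q + X q r + X r s + X s p - X p r - X q s) ∧
        (∀ p q r c, p ≠ c → q ≠ c → r ≠ c →
          2 ≤ 2 * X p c + 2 * X q c + 2 * X r c - X p q - X p r - X q r)} := by
    ext X
    exact ⟨fun h => ⟨h.symm, h.zero, h.tri, h.one, h.quad, h.star⟩,
      fun h => ⟨h.1, h.2.1, h.2.2.1, h.2.2.2.1, h.2.2.2.2.1, h.2.2.2.2.2⟩⟩
  rw [e]
  simp only [Set.ofPred_and, Set.ofPred_forall]
  refine IsClosed.inter ?_ (IsClosed.inter ?_ (IsClosed.inter ?_ (IsClosed.inter ?_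
    (IsClosed.inter ?_ ?_))))
  · exact isClosed_iInter fun i => isClosed_iInter fun j => isClosed_eq (hc _ _) (hc _ _)
  · exact isClosed_iInter fun i => isClosed_eq (hc _ _) continuous_const
  · exact isClosed_iInter fun i => isClosed_iInter fun j => isClosed_iInter fun k =>
      isClosed_le continuous_const (((hc _ _).add (hc _ _)).sub (hc _ _))
  · exact isClosed_iInter fun i => isClosed_iInter fun j => isClosed_iInter fun _ =>
      isClosed_le continuous_const (hc _ _)
  · exact isClosed_iInter fun p => isClosed_iInter fun q => isClosed_iInter fun r =>
      isClosed_iInter fun s => isClosed_iInter fun _ => isClosed_iInter fun _ =>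
      isClosed_iInter fun _ => isClosed_iInter fun _ => isClosed_iInter fun _ =>
      isClosed_iInter fun _ => isClosed_le continuous_const
        ((((((hc _ _).add (hc _ _)).add (hc _ _)).add (hc _ _)).sub (hc _ _)).sub (hc _ _))
  · exact isClosed_iInter fun p => isClosed_iInter fun q => isClosed_iInter fun r =>
      isClosed_iInter fun s => isClosed_iInter fun _ => isClosed_iInter fun _ =>
      isClosed_iInter fun _ => isClosed_le continuous_const
        (((((((hc _ _).const_mul 2).add ((hc _ _).const_mul 2)).add ((hc _ _).const_mul 2)).sub
          (hc _ _)).sub (hc _ _)).sub (hc _ _))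

theorem good_of_closure {n : ℕ} {X : Matrix (Fin n) (Fin n) ℝ} (h : X ∈ closure (Qn n)) :
    Good X := by
  have h1 : Qn n ⊆ {X | Good X} := by
    refine convexHull_min ?_ (good_convex n)
    rintro _ ⟨x, hx, rfl⟩
    exact good_mmap x hx
  exact closure_minimal h1 (good_closed n) h

theorem tight_aux {a b u v : ℝ} (ha : 0 < a) (hb : 0 < b) (hu : 0 ≤ u) (hv : 0 ≤ v)
    (h : a * u + b * v = 0) : u = 0 := by
  have h1 := mul_nonneg hb.le hv
  have h2 := mul_nonneg ha.le hu
  have : a * u = 0 := by linarith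
  rcases mul_eq_zero.1 this with h | h
  · linarith
  · exact h

/-- Purely numerical form of the constraints on functions on `ℕ`. -/
structure GoodN (n : ℕ) (D : ℕ → ℕ → ℝ) : Prop where
  symm : ∀ i j, D i j = D j i
  tri : ∀ i j k, 0 ≤ D i j + D j k - D i k
  quad : ∀ p q r s, p < n → q < n → r < n → s < n →
    p ≠ q → q ≠ r → r ≠ s → s ≠ p → p ≠ r → q ≠ s →
    2 ≤ D p q + D q r + D r s + D s p - D p r - D q s
  star : ∀ p q r c, p < n → q < n → r < n → c < n → p ≠ c → q ≠ c → r ≠ c →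
    2 ≤ 2 * D p c + 2 * D q c + 2 * D r c - D p q - D p r - D q r

/-- parity indicator -/
def par (m : ℕ) : ℝ := if m % 2 = 1 then 1 else 0

theorem window {n : ℕ} {D E : ℕ → ℕ → ℝ} (hD : GoodN n D) (hE : GoodN n E) {a b τ : ℝ}
    (ha : 0 < a) (hb : 0 < b) (hab : a + b = 1)
    (hs : ∀ k m, k + m < n → a * D k (k + m) + b * E k (k + m) = m + τ * par m)
    (k : ℕ) (hk : k + 4 < n) :
    (D (k+1) (k+2) = D k (k+1) ∧ D (k+2) (k+3) = D k (k+1) ∧ D (k+3) (k+4) = D k (k+1)) ∧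
    (D k (k+2) = 2 ∧ D (k+1) (k+3) = 2 ∧ D (k+2) (k+4) = 2) := by
  have s01 := hs k 1 (by omega)
  have s02 := hs k 2 (by omega)
  have s03 := hs k 3 (by omega)
  have s04 := hs k 4 (by omega)
  have s12 := hs (k+1) 1 (by omega)
  have s13 := hs (k+1) 2 (by omega)
  have s14 := hs (k+1) 3 (by omega)
  have s23 := hs (k+2) 1 (by omega)
  have s24 := hs (k+2) 2 (by omega)
  have s34 := hs (k+3) 1 (by omega)
  norm_num [par, add_assoc] at s01 s02 s03 s04 s12 s13 s14 s23 s24 s34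
  have tri : ∀ i j l, a * (D i j + D j l - D i l) + b * (E i j + E j l - E i l) = 0 →
      D i j + D j l - D i l = 0 := fun i j l h =>
    tight_aux ha hb (hD.tri i j l) (hE.tri i j l) h
  have t1 := tri (k+1) (k+3) (k+4) (by linarith)
  have t2 := tri (k+1) (k+2) (k+4) (by linarith)
  have t3 := tri k (k+2) (k+3) (by linarith)
  have t4 := tri k (k+2) (k+4) (by linarith)
  have t5 := tri k (k+1) (k+3) (by linarith)
  have q1 : D (k+1) (k+2) + D (k+2) (k+4) + D (k+3) (k+4) + D (k+1) (k+3)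
      - D (k+1) (k+4) - D (k+2) (k+3) - 2 = 0 := by
    have h1 := hD.quad (k+1) (k+2) (k+4) (k+3) (by omega) (by omega) (by omega) (by omega)
      (by omega) (by omega) (by omega) (by omega) (by omega) (by omega)
    have h2 := hE.quad (k+1) (k+2) (k+4) (k+3) (by omega) (by omega) (by omega) (by omega)
      (by omega) (by omega) (by omega) (by omega) (by omega) (by omega)
    rw [hD.symm (k+4) (k+3), hD.symm (k+3) (k+1)] at h1
    rw [hE.symm (k+4) (k+3), hE.symm (k+3) (k+1)] at h2
    exact tight_aux ha hb (v := E (k+1) (k+2) + E (k+2) (k+4) + E (k+3) (k+4) + E (k+1) (k+3)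
      - E (k+1) (k+4) - E (k+2) (k+3) - 2) (by linarith) (by linarith) (by linarith)
  have q2 : D k (k+1) + D (k+1) (k+3) + D (k+2) (k+3) + D k (k+2)
      - D k (k+3) - D (k+1) (k+2) - 2 = 0 := by
    have h1 := hD.quad k (k+1) (k+3) (k+2) (by omega) (by omega) (by omega) (by omega)
      (by omega) (by omega) (by omega) (by omega) (by omega) (by omega)
    have h2 := hE.quad k (k+1) (k+3) (k+2) (by omega) (by omega) (by omega) (by omega)
      (by omega) (by omega) (by omega) (by omega) (by omega) (by omega)
    rw [hD.symm (k+3) (k+2), hD.symm (k+2) k] at h1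
    rw [hE.symm (k+3) (k+2), hE.symm (k+2) k] at h2
    exact tight_aux ha hb (v := E k (k+1) + E (k+1) (k+3) + E (k+2) (k+3) + E k (k+2)
      - E k (k+3) - E (k+1) (k+2) - 2) (by linarith) (by linarith) (by linarith)
  have q3 : D k (k+1) + D (k+1) (k+3) + D (k+3) (k+4) + D k (k+4)
      - D k (k+3) - D (k+1) (k+4) - 2 = 0 := by
    have h1 := hD.quad k (k+1) (k+3) (k+4) (by omega) (by omega) (by omega) (by omega)
      (by omega) (by omega) (by omega) (by omega) (by omega) (by omega)
    have h2 := hE.quad k (k+1) (k+3) (k+4) (by omega) (by omega) (by omega) (by omega)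
      (by omega) (by omega) (by omega) (by omega) (by omega) (by omega)
    rw [hD.symm (k+4) k] at h1
    rw [hE.symm (k+4) k] at h2
    exact tight_aux ha hb (v := E k (k+1) + E (k+1) (k+3) + E (k+3) (k+4) + E k (k+4)
      - E k (k+3) - E (k+1) (k+4) - 2) (by linarith) (by linarith) (by linarith)
  have q4 : 2 * D k (k+2) + 2 * D (k+1) (k+2) + 2 * D (k+2) (k+4)
      - D k (k+1) - D k (k+4) - D (k+1) (k+4) - 2 = 0 := by
    have h1 := hD.star k (k+1) (k+4) (k+2) (by omega) (by omega) (by omega) (by omega)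
      (by omega) (by omega) (by omega)
    have h2 := hE.star k (k+1) (k+4) (k+2) (by omega) (by omega) (by omega) (by omega)
      (by omega) (by omega) (by omega)
    rw [hD.symm (k+4) (k+2)] at h1
    rw [hE.symm (k+4) (k+2)] at h2
    exact tight_aux ha hb (v := 2 * E k (k+2) + 2 * E (k+1) (k+2) + 2 * E (k+2) (k+4)
      - E k (k+1) - E k (k+4) - E (k+1) (k+4) - 2) (by linarith) (by linarith) (by linarith)
  refine ⟨⟨?_, ?_, ?_⟩, ?_, ?_, ?_⟩ <;> linarith

theorem cases3 {n k : ℕ} (hn : 5 ≤ n) (hk : k + 2 < n) :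
    k + 4 < n ∨ (∃ j, k = j + 1 ∧ j + 4 < n) ∨ (∃ j, k = j + 2 ∧ j + 4 < n) := by
  by_cases h1 : k + 4 < n
  · exact Or.inl h1
  · by_cases h2 : k + 3 < n
    · exact Or.inr (Or.inl ⟨k - 1, by omega, by omega⟩)
    · exact Or.inr (Or.inr ⟨k - 2, by omega, by omega⟩)

theorem steps {n : ℕ} (hn : 5 ≤ n) {D : ℕ → ℕ → ℝ}
    (hw : ∀ k, k + 4 < n →
    (D (k+1) (k+2) = D k (k+1) ∧ D (k+2) (k+3) = D k (k+1) ∧ D (k+3) (k+4) = D k (k+1)) ∧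
    (D k (k+2) = 2 ∧ D (k+1) (k+3) = 2 ∧ D (k+2) (k+4) = 2)) :
    (∀ k, k + 1 < n → D k (k+1) = D 0 1) ∧ (∀ k, k + 2 < n → D k (k+2) = 2) := by
  constructor
  · intro k
    induction k with
    | zero => intro _; rfl
    | succ k ih =>
      intro hk
      rw [← ih (by omega)]
      rcases cases3 hn hk
        with h | ⟨j, rfl, h⟩ | ⟨j, rfl, h⟩
      · exact (hw k h).1.1
      · have := (hw j h).1
        exact this.2.1.trans this.1.symm
      · have := (hw j h).1
        exact this.2.2.trans this.2.1.symm
  · intro k hk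
    rcases cases3 hn hk
        with h | ⟨j, rfl, h⟩ | ⟨j, rfl, h⟩
    · exact (hw k h).2.1
    · exact (hw j h).2.2.1
    · exact (hw j h).2.2.2

theorem upper {n : ℕ} {D : ℕ → ℕ → ℝ} (hD : GoodN n D) (h0 : ∀ k, D k k = 0)
    (h1 : ∀ k, k + 1 < n → D k (k+1) = D 0 1) (h2 : ∀ k, k + 2 < n → D k (k+2) = 2)
    (m : ℕ) : ∀ k, k + m < n → D k (k + m) ≤ m + (D 0 1 - 1) * par m := by
  induction m using Nat.strong_induction_on with
  | _ m ih =>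
    intro k hk
    match m, ih, hk with
    | 0, _, _ => simp [par, h0]
    | 1, _, hk => rw [h1 k hk]; norm_num [par]
    | m + 2, ih, hk =>
      have e1 := ih m (by omega) (k + 2) (by omega)
      have e2 := hD.tri k (k + 2) (k + 2 + m)
      rw [h2 k (by omega)] at e2
      have e3 : k + (m + 2) = k + 2 + m := by ring
      have e4 : par (m + 2) = par m := by simp [par]
      rw [e3, e4]
      push_cast
      linarith

theorem core {n : ℕ} (hn : 5 ≤ n) {D E : ℕ → ℕ → ℝ} (hD : GoodN n D) (hE : GoodN n E)
    (hD0 : ∀ k, D k k = 0) (hE0 : ∀ k, E k k = 0) {a b τ : ℝ}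
    (ha : 0 < a) (hb : 0 < b) (hab : a + b = 1)
    (hs : ∀ k m, k + m < n → a * D k (k + m) + b * E k (k + m) = m + τ * par m)
    (k m : ℕ) (hk : k + m < n) : D k (k + m) = m + (D 0 1 - 1) * par m := by
  obtain ⟨d1, d2⟩ := steps hn (window hD hE ha hb hab hs)
  obtain ⟨e1, e2⟩ := steps hn (window hE hD hb ha (by linarith)
    (fun k m h => by have := hs k m h; linarith))
  have u1 := upper hD hD0 d1 d2 m k hk
  have u2 := upper hE hE0 e1 e2 m k hk
  have s := hs k m hk
  have s1 := hs 0 1 (by omega)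
  norm_num [par] at s1
  have hτ : τ = a * (D 0 1 - 1) + b * (E 0 1 - 1) := by linarith
  have hm : (m : ℝ) = a * m + b * m := by rw [← add_mul, hab, one_mul]
  have := tight_aux ha hb (sub_nonneg.2 u1) (sub_nonneg.2 u2) (by
    rw [hτ] at s
    linear_combination (-1 : ℝ) * s - hm)
  linarith

theorem goodN_of_good {n : ℕ} [NeZero n] {X : Matrix (Fin n) (Fin n) ℝ} (h : Good X) :
    GoodN n (fun k l => X (Fin.ofNat n k) (Fin.ofNat n l)) := by
  have hne : ∀ {i j}, i < n → j < n → i ≠ j → Fin.ofNat n i ≠ Fin.ofNat n j := by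
    intro i j hi hj hij he
    have := congrArg Fin.val he
    simp only [Fin.val_ofNat, Nat.mod_eq_of_lt hi, Nat.mod_eq_of_lt hj] at this
    exact hij this
  refine ⟨fun _ _ => h.symm _ _, fun _ _ _ => h.tri _ _ _, ?_, ?_⟩
  · intro p q r s hp hq hr hs h1 h2 h3 h4 h5 h6
    exact h.quad _ _ _ _ (hne hp hq h1) (hne hq hr h2) (hne hr hs h3) (hne hs hp h4)
      (hne hp hr h5) (hne hq hs h6)
  · intro p q r c hp hq hr hc h1 h2 h3
    exact h.star _ _ _ _ (hne hp hc h1) (hne hq hc h2) (hne hr hc h3)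

theorem mem_closure_aux {n : ℕ} (U : Finset (Fin n)) (t : ℝ) (ht : 0 ≤ t) :
    Mperm 1 + t • mmap (chi U) ∈ closure (Qn n) := by
  have hid : ∀ k l : Fin n, k ≠ l → 1 ≤ |permVec 1 k - permVec 1 l| := by
    intro k l h
    have h' : ((k : ℕ) : ℤ) - (l : ℕ) ≠ 0 := by
      intro h0; apply h; ext; omega
    have := Int.one_le_abs h'
    simp only [permVec, Equiv.Perm.coe_one, id]
    rw [add_sub_add_right_eq_sub]
    exact_mod_cast this
  let Z : ℕ → Matrix (Fin n) (Fin n) ℝ := fun m =>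
    (1 - t / m) • Mperm 1 + (t / m) • mmap (fun j => permVec 1 j + m * chi U j)
  have hinv : Filter.Tendsto (fun m : ℕ => t / (m : ℝ)) Filter.atTop (nhds 0) :=
    tendsto_const_div_atTop_nhds_zero_nat t
  have hlim : Filter.Tendsto Z Filter.atTop (nhds (Mperm 1 + t • mmap (chi U))) := by
    refine tendsto_pi_nhds.2 fun k => tendsto_pi_nhds.2 fun l => ?_
    have g1 : Filter.Tendsto (fun m : ℕ => (1 - t / (m : ℝ)) * |permVec (1 : Equiv.Perm (Fin n)) k - permVec 1 l|
        + t * |(permVec (1 : Equiv.Perm (Fin n)) k - permVec 1 l) / (m : ℝ) + (chi U k - chi U l)|) Filter.atTop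
        (nhds ((1 - 0) * |permVec (1 : Equiv.Perm (Fin n)) k - permVec 1 l| + t * |0 + (chi U k - chi U l)|)) := by
      refine ((tendsto_const_nhds.sub hinv).mul_const _).add (Filter.Tendsto.const_mul t ?_)
      exact ((tendsto_const_div_atTop_nhds_zero_nat _).add_const _).abs
    have e : (Mperm 1 + t • mmap (chi U) : Matrix (Fin n) (Fin n) ℝ) k l =
        (1 - 0) * |permVec (1 : Equiv.Perm (Fin n)) k - permVec 1 l| + t * |0 + (chi U k - chi U l)| := by
      simp [Mperm, mmap]
    rw [e]
    refine g1.congr' ?_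
    filter_upwards [Filter.eventually_gt_atTop 0] with m hm
    have hm' : (0 : ℝ) < m := by exact_mod_cast hm
    simp only [Z, Matrix.add_apply, Matrix.smul_apply, smul_eq_mul, Mperm, mmap]
    congr 1
    have e2 : permVec (1 : Equiv.Perm (Fin n)) k + m * chi U k - (permVec 1 l + m * chi U l) =
        m * ((permVec (1 : Equiv.Perm (Fin n)) k - permVec 1 l) / (m : ℝ) + (chi U k - chi U l)) := by
      field_simp; ring
    rw [e2, abs_mul, abs_of_pos hm']
    field_simp
  refine mem_closure_of_tendsto hlim ?_
  obtain ⟨N, hN⟩ := exists_nat_ge t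
  filter_upwards [Filter.eventually_ge_atTop (n + 1), Filter.eventually_ge_atTop N] with m hm hm2
  have hm' : (n : ℝ) + 1 ≤ m := by exact_mod_cast hm
  have hmp : (0 : ℝ) < m := by have : (0:ℝ) ≤ n := Nat.cast_nonneg n
                               linarith
  have htm : t ≤ m := hN.trans (by exact_mod_cast hm2)
  refine convex_convexHull ℝ (Ebn n) (subset_convexHull ℝ _ ⟨_, hid, rfl⟩)
    (subset_convexHull ℝ _ ⟨_, ?_, rfl⟩) ?_ (by positivity) (by ring)
  · intro k l h
    have hk := hid k l h
    have b1 : ((k : ℕ) : ℝ) + 1 ≤ n := by exact_mod_cast k.2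
    have b2 : ((l : ℕ) : ℝ) + 1 ≤ n := by exact_mod_cast l.2
    have c1 : (0 : ℝ) ≤ (k : ℕ) := Nat.cast_nonneg _
    have c2 : (0 : ℝ) ≤ (l : ℕ) := Nat.cast_nonneg _
    by_cases hkU : k ∈ U <;> by_cases hlU : l ∈ U <;>
      simp only [chi, hkU, hlU, if_true, if_false, permVec, Equiv.Perm.coe_one, id] at hk ⊢
    · rw [add_sub_add_right_eq_sub]; exact hk
    · exact le_abs.2 (Or.inl (by linarith))
    · exact le_abs.2 (Or.inr (by linarith))
    · rw [add_sub_add_right_eq_sub]; exact hk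
  · have : t / m ≤ 1 := (div_le_one hmp).2 htm
    linarith

theorem chi_par {n : ℕ} (U : Finset (Fin n))
    (hU : U = Finset.univ.filter (fun j : Fin n => Odd ((j : ℕ) + 1)) ∨
          U = Finset.univ.filter (fun j : Fin n => Even ((j : ℕ) + 1)))
    (i j : Fin n) (m : ℕ) (h : (j : ℕ) = i + m) : mmap (chi U) i j = par m := by
  have e1 : Odd m ∨ Even m := (Nat.even_or_odd m).symm
  rcases hU with rfl | rfl <;>
  simp only [mmap, chi, par, Finset.mem_filter, Finset.mem_univ, true_and, Nat.odd_iff,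
    Nat.even_iff, h] <;>
  split_ifs <;> first | omega | norm_num

theorem mperm_par {n : ℕ} (i j : Fin n) (m : ℕ) (h : (j : ℕ) = i + m) :
    (Mperm 1 : Matrix (Fin n) (Fin n) ℝ) i j = m := by
  simp only [Mperm, mmap, permVec, Equiv.Perm.coe_one, id, h]
  push_cast
  rw [abs_sub_comm]
  have : ((i : ℕ) : ℝ) + m + 1 - ((i : ℕ) + 1) = m := by ring
  rw [this, abs_of_nonneg (Nat.cast_nonneg m)]

theorem stmt17 (n : ℕ) (hn : 5 ≤ n) (U : Finset (Fin n))
    (hU : U = Finset.univ.filter (fun j : Fin n => Odd ((j : ℕ) + 1)) ∨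
          U = Finset.univ.filter (fun j : Fin n => Even ((j : ℕ) + 1))) :
    IsExtreme ℝ (closure (Qn n)) (halfline 1 U) := by
  have : NeZero n := ⟨by omega⟩
  refine ⟨?_, ?_⟩
  · rintro _ ⟨t, ht, rfl⟩
    exact mem_closure_aux U t ht
  · rintro X hX Y hY _ ⟨τ, hτ, rfl⟩ ⟨a, b, ha, hb, hab, hXY⟩
    have gX := good_of_closure hX
    have gY := good_of_closure hY
    have val : ∀ i, i < n → ((Fin.ofNat n i : Fin n) : ℕ) = i := fun i hi => by
      simp [Nat.mod_eq_of_lt hi]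
    have hs : ∀ k m, k + m < n →
        a * X (Fin.ofNat n k) (Fin.ofNat n (k + m)) + b * Y (Fin.ofNat n k) (Fin.ofNat n (k + m))
          = m + τ * par m := by
      intro k m hk
      have hv : ((Fin.ofNat n (k + m) : Fin n) : ℕ) = (Fin.ofNat n k : Fin n) + m := by
        rw [val _ hk, val _ (by omega)]
      have := congrFun (congrFun hXY (Fin.ofNat n k)) (Fin.ofNat n (k + m))
      simp only [Matrix.add_apply, Matrix.smul_apply, smul_eq_mul] at this
      rw [this, chi_par U hU _ _ m hv, mperm_par _ _ m hv]
    have key := core hn (goodN_of_good gX) (goodN_of_good gY) (fun _ => gX.zero _)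
      (fun _ => gY.zero _) ha hb hab hs
    set T := X (Fin.ofNat n 0) (Fin.ofNat n 1) with hT
    have hT1 : 1 ≤ T := by
      apply gX.one
      intro h
      have := congrArg Fin.val h
      rw [val 0 (by omega), val 1 (by omega)] at this
      omega
    have main : ∀ i j : Fin n, i ≤ j → X i j =
        (Mperm 1 + (T - 1) • mmap (chi U) : Matrix (Fin n) (Fin n) ℝ) i j := by
      intro i j hij
      obtain ⟨m, hm⟩ := Nat.exists_eq_add_of_le (Fin.le_def.1 hij)
      have hk := key i m (by have := j.2; omega)
      have ei : Fin.ofNat n (i : ℕ) = i := Fin.ext (val _ i.2)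
      have ej : Fin.ofNat n ((i : ℕ) + m) = j := Fin.ext (by
        rw [val _ (by have := j.2; omega)]; omega)
      simp only [ei, ej] at hk
      rw [hk]
      simp only [Matrix.add_apply, Matrix.smul_apply, smul_eq_mul]
      rw [chi_par U hU _ _ m hm, mperm_par _ _ m hm]
    refine ⟨T - 1, by linarith, ?_⟩
    ext i j
    rcases le_total i j with h | h
    · exact main i j h
    · rw [gX.symm, main j i h]
      simp only [Matrix.add_apply, Matrix.smul_apply, Mperm, mmap]
      rw [abs_sub_comm, abs_sub_comm (chi U j)]
end
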